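/- arXiv:2504.14599 — 3 statements merged into one kernel-verified Lean document; each statement's English description precedes it below -/
import Mathlib

section
/- One has t(4) + 2(t(3,1) + t(2,2)) + 4·t(2,1,1) = (2/3)·t(2)² + 2·t(2)·log²(2), where t(2) = Σ_{m ≥ 1 odd} 1/m² = π²/8. -/
/-- Multiple t-value of level `N` with residue `a`:
`t_{N,a}(k) = Σ_{m₁ > ⋯ > mₙ > 0, mᵢ ≡ a (mod N)} 1/(m₁^{k₁} ⋯ mₙ^{kₙ})`. -/
noncomputable def tv (N a : ℕ) (k : List ℕ) : ℝ :=
  ∑' m : {f : Fin k.length → ℕ // StrictAnti f ∧ ∀ i, 0 < f i ∧ f i % N = a % N},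
    ∏ i : Fin k.length, ((m.1 i : ℝ) ^ k.get i)⁻¹

section

open Filter Topology Finset

/-- General term of the well-poised series. -/
noncomputable def wpTerm (y : ℝ) (N : ℕ) : ℕ → ℝ
  | 0 => 1
  | n + 1 => wpTerm y N n *
      (((N + n + 1) * (N + 2 * n + 3) * (2 * n + 1) ^ 2 * (2 * n + 1 - y)) /
        ((n + 1) * (N + 2 * n + 1) * (2 * n + 3 + 2 * N) ^ 2 * (2 * n + 3 + y + 2 * N)))

theorem wpTerm_nonneg {y : ℝ} (hy : 0 ≤ y) (hy1 : y ≤ 1) (N n : ℕ) : 0 ≤ wpTerm y N n := by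
  induction n with
  | zero => simp [wpTerm]
  | succ n ih =>
    have hn : (0 : ℝ) ≤ n := n.cast_nonneg
    have : (0 : ℝ) ≤ 2 * n + 1 - y := by linarith
    rw [wpTerm]
    positivity

theorem wpTerm_succ_left {y : ℝ} (hy : 0 ≤ y) (N n : ℕ) :
    wpTerm y (N + 1) n = wpTerm y N n *
      (((1 + N + n) * (2 + N + 2 * n) * (2 * N + 3) ^ 2 * (2 * N + 3 + y)) /
        ((2 + N) * (1 + N + 2 * n) * (2 * N + 3 + 2 * n) ^ 2 * (2 * N + 3 + 2 * n + y))) := by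
  induction n with
  | zero =>
    simp only [wpTerm, Nat.cast_zero]
    field_simp
    ring
  | succ n ih =>
    rw [wpTerm, wpTerm, ih]
    push_cast
    field_simp
    ring

/-- The telescoping certificate. -/
theorem wpTerm_sub_eq {y : ℝ} (hy : 0 ≤ y) (N n : ℕ) :
    wpTerm y N n - 4 * (2 + N) * (1 + N) * (2 * N + 2 + y) ^ 2 /
        ((2 * N + 3) ^ 2 * (2 * N + 3 + y) * (2 * N + 1 + y)) * wpTerm y (N + 1) n =
      -((n + 1 : ℕ) * (2 * (n + 1 : ℕ) + 4 * N + 3 + y) /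
          ((2 * N + 1 + y) * (N + 1 + 2 * (n + 1 : ℕ))) * wpTerm y N (n + 1)) -
        -(n * (2 * n + 4 * N + 3 + y) / ((2 * N + 1 + y) * (N + 1 + 2 * n)) * wpTerm y N n) := by
  rw [wpTerm_succ_left hy, wpTerm]
  push_cast
  field_simp
  ring

theorem wpTerm_le_div {y : ℝ} (hy : 0 ≤ y) (hy1 : y ≤ 1) (N : ℕ) {n : ℕ} (hn : 1 ≤ n) :
    wpTerm y N n ≤ wpTerm y 0 n / (N + 1) := by
  induction N with
  | zero => simp
  | succ N ih =>
    have hn' : (1 : ℝ) ≤ n := by exact_mod_cast hn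
    have hN : (0 : ℝ) ≤ N := N.cast_nonneg
    have key : ((1 + N + n) * (2 + N + 2 * n) * (2 * N + 3) ^ 2 * (2 * N + 3 + y)) /
        ((2 + N) * (1 + N + 2 * n) * (2 * N + 3 + 2 * n) ^ 2 * (2 * N + 3 + 2 * n + y)) ≤
          ((N : ℝ) + 1) / (N + 2) := by
      have h1 : ((1 : ℝ) + N + n) * (2 * N + 3) ^ 2 ≤ (N + 1) * (2 * N + 3 + 2 * n) ^ 2 := by
        nlinarith [mul_nonneg hN (by linarith : (0 : ℝ) ≤ n),
          mul_nonneg (mul_nonneg hN hN) (by linarith : (0 : ℝ) ≤ n),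
          mul_nonneg hN (sq_nonneg (n : ℝ))]
      have h2 : ((2 : ℝ) + N + 2 * n) * (2 * N + 3 + y) ≤
          (1 + N + 2 * n) * (2 * N + 3 + 2 * n + y) := by
        nlinarith [mul_nonneg hN (by linarith : (0 : ℝ) ≤ n - 1)]
      rw [div_le_div_iff₀ (by positivity) (by positivity)]
      calc _ = (((1 : ℝ) + N + n) * (2 * N + 3) ^ 2) * (((2 : ℝ) + N + 2 * n) * (2 * N + 3 + y))
              * (N + 2) := by ring
        _ ≤ ((N + 1) * (2 * N + 3 + 2 * n) ^ 2) * ((1 + N + 2 * n) * (2 * N + 3 + 2 * n + y))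
              * (N + 2) := by gcongr
        _ = _ := by ring
    rw [wpTerm_succ_left hy]
    calc _ ≤ wpTerm y 0 n / (N + 1) * (((N : ℝ) + 1) / (N + 2)) := by
          gcongr
          exact div_nonneg (wpTerm_nonneg hy hy1 _ _) (by positivity)
      _ = _ := by push_cast; field_simp; ring

/-- `∏_{j < 2n+1, j odd} (j - y) / (j + y)`. -/
noncomputable def oddProd (y : ℝ) (n : ℕ) : ℝ :=
  ∏ i ∈ range n, (2 * i + 1 - y) / (2 * i + 1 + y)

theorem oddProd_mem {y : ℝ} (hy : 0 ≤ y) (hy1 : y ≤ 1) (n : ℕ) :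
    0 ≤ oddProd y n ∧ oddProd y n ≤ 1 := by
  have h (i : ℕ) : (0 : ℝ) ≤ 2 * i + 1 - y := by
    have : (0 : ℝ) ≤ i := i.cast_nonneg
    linarith
  refine ⟨prod_nonneg fun i _ ↦ div_nonneg (h i) (by positivity),
    prod_le_one (fun i _ ↦ div_nonneg (h i) (by positivity)) fun i _ ↦ ?_⟩
  rw [div_le_one (by positivity)]
  linarith

theorem wpTerm_zero_left {y : ℝ} (hy : 0 ≤ y) (n : ℕ) :
    wpTerm y 0 n = (1 + y) * (oddProd y n / ((2 * n + 1) * (2 * n + 1 + y))) := by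
  induction n with
  | zero => simp [wpTerm, oddProd]; field_simp
  | succ n ih =>
    rw [wpTerm, ih, oddProd, oddProd, prod_range_succ]
    push_cast
    field_simp
    ring

theorem summable_odd_sq : Summable fun n : ℕ ↦ 1 / (2 * (n : ℝ) + 1) ^ 2 := by
  have := (Real.summable_one_div_nat_pow (p := 2)).2 (by norm_num)
  simpa [Function.comp_def] using
    this.comp_injective (i := fun n : ℕ ↦ 2 * n + 1) fun a b h ↦ by simpa using h

theorem wpTerm_le {y : ℝ} (hy : 0 ≤ y) (hy1 : y ≤ 1) (N n : ℕ) :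
    wpTerm y N n ≤ 2 / (2 * n + 1) ^ 2 := by
  have h0 : wpTerm y 0 n ≤ 2 / (2 * n + 1) ^ 2 := by
    obtain ⟨h1, h2⟩ := oddProd_mem hy hy1 n
    calc _ = (1 + y) * (oddProd y n / ((2 * n + 1) * (2 * n + 1 + y))) := wpTerm_zero_left hy n
      _ ≤ (1 + 1) * (1 / ((2 * n + 1) * (2 * n + 1 + 0))) := by gcongr
      _ = _ := by field_simp; ring
  rcases Nat.eq_zero_or_pos n with rfl | hn
  · simp [wpTerm]
  · refine (wpTerm_le_div hy hy1 N hn).trans ((div_le_self ?_ ?_).trans h0)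
    · exact wpTerm_nonneg hy hy1 _ _
    · simp

theorem summable_wpTerm {y : ℝ} (hy : 0 ≤ y) (hy1 : y ≤ 1) (N : ℕ) : Summable (wpTerm y N) :=
  .of_nonneg_of_le (wpTerm_nonneg hy hy1 N) (wpTerm_le hy hy1 N)
    (by simpa [div_eq_mul_inv] using summable_odd_sq.mul_left 2)

theorem tsum_wpTerm_succ {y : ℝ} (hy : 0 ≤ y) (hy1 : y ≤ 1) (N : ℕ) :
    ∑' n, wpTerm y N n = 4 * (2 + N) * (1 + N) * (2 * N + 2 + y) ^ 2 /
        ((2 * N + 3) ^ 2 * (2 * N + 3 + y) * (2 * N + 1 + y)) * ∑' n, wpTerm y (N + 1) n := by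
  set ρ : ℝ := 4 * (2 + N) * (1 + N) * (2 * N + 2 + y) ^ 2 /
        ((2 * N + 3) ^ 2 * (2 * N + 3 + y) * (2 * N + 1 + y)) with hρ
  set v : ℕ → ℝ := fun n ↦ -(n * (2 * n + 4 * N + 3 + y) /
    ((2 * N + 1 + y) * (N + 1 + 2 * n)) * wpTerm y N n) with hv
  have hs : HasSum (fun n ↦ wpTerm y N n - ρ * wpTerm y (N + 1) n)
      (∑' n, wpTerm y N n - ρ * ∑' n, wpTerm y (N + 1) n) :=
    (summable_wpTerm hy hy1 N).hasSum.sub ((summable_wpTerm hy hy1 (N + 1)).hasSum.mul_left ρ)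
  have h1 : (fun K ↦ ∑ n ∈ range K, (wpTerm y N n - ρ * wpTerm y (N + 1) n)) = v := by
    funext K
    have : ∀ n, wpTerm y N n - ρ * wpTerm y (N + 1) n = v (n + 1) - v n := fun n ↦ by
      rw [hρ, hv]; exact wpTerm_sub_eq hy N n
    simp_rw [this, sum_range_sub]
    simp [hv]
  have h2 : Tendsto v atTop (𝓝 0) := by
    have hb : Tendsto (fun n : ℕ ↦ ((4 * N + 4 : ℝ)) * (1 / ((n : ℝ) + 1))) atTop (𝓝 0) := by
      simpa using tendsto_one_div_add_atTop_nhds_zero_nat.const_mul (4 * N + 4 : ℝ)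
    refine squeeze_zero_norm (fun n ↦ ?_) hb
    have hw := wpTerm_nonneg hy hy1 N n
    have hn : (0 : ℝ) ≤ n := n.cast_nonneg
    have hN : (0 : ℝ) ≤ N := N.cast_nonneg
    rw [hv, norm_neg, Real.norm_of_nonneg (by positivity)]
    have h3 : (n : ℝ) * (2 * n + 4 * N + 3 + y) / ((2 * N + 1 + y) * (N + 1 + 2 * n)) ≤
        n * (4 * N + 4) := by
      rw [div_le_iff₀ (by positivity), mul_assoc]
      gcongr
      have : (1 : ℝ) * (N + 1 + 2 * n) ≤ (2 * N + 1 + y) * (N + 1 + 2 * n) := by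
        gcongr
        linarith
      nlinarith [mul_nonneg hn hN]
    calc _ ≤ (n : ℝ) * (4 * N + 4) * (2 / (2 * n + 1) ^ 2) := by
          gcongr
          exact wpTerm_le hy hy1 N n
      _ ≤ _ := by
          rw [mul_one_div, mul_div_assoc', div_le_div_iff₀ (by positivity) (by positivity)]
          have : (n : ℝ) * 2 * (n + 1) ≤ (2 * n + 1) ^ 2 := by nlinarith
          nlinarith [mul_le_mul_of_nonneg_left this (by positivity : (0 : ℝ) ≤ 4 * N + 4)]
  have := tendsto_nhds_unique (h1 ▸ hs.tendsto_sum_nat) h2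
  linarith

theorem tendsto_tsum_wpTerm {y : ℝ} (hy : 0 ≤ y) (hy1 : y ≤ 1) :
    Tendsto (fun N ↦ ∑' n, wpTerm y N n) atTop (𝓝 1) := by
  have hb : Tendsto (fun N : ℕ ↦ 1 + (∑' n, wpTerm y 0 (n + 1)) * (1 / ((N : ℝ) + 1)))
      atTop (𝓝 1) := by
    simpa using (tendsto_one_div_add_atTop_nhds_zero_nat.const_mul
      (∑' n, wpTerm y 0 (n + 1))).const_add 1
  have h0 (N : ℕ) : ∑' n, wpTerm y N n = 1 + ∑' n, wpTerm y N (n + 1) := by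
    rw [(summable_wpTerm hy hy1 N).tsum_eq_zero_add, wpTerm]
  have hs (N : ℕ) : Summable fun n ↦ wpTerm y N (n + 1) :=
    (summable_nat_add_iff 1).2 (summable_wpTerm hy hy1 N)
  refine tendsto_of_tendsto_of_tendsto_of_le_of_le tendsto_const_nhds hb (fun N ↦ ?_) fun N ↦ ?_
  · rw [h0]
    exact le_add_of_nonneg_right (tsum_nonneg fun n ↦ wpTerm_nonneg hy hy1 _ _)
  · rw [h0, ← tsum_mul_right]
    gcongr
    · exact hs N
    · exact (hs 0).mul_right _
    · simpa [div_eq_mul_inv] using wpTerm_le_div hy hy1 N (Nat.succ_pos _)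

/-- Partial products of `∏ (1 + y / (2k + 2)) / (1 + y / (2k + 1))`. -/
noncomputable def ratioProd (y : ℝ) (N : ℕ) : ℝ :=
  ∏ k ∈ range N, (2 * k + 2 + y) * (2 * k + 1) / ((2 * k + 2) * (2 * k + 1 + y))

theorem tsum_wpTerm_zero_mul {y : ℝ} (hy : 0 ≤ y) (hy1 : y ≤ 1) (N : ℕ) :
    (∑' n, wpTerm y 0 n) * (∑' n, wpTerm 0 N n) * (2 * N + 1 + y) =
      (∑' n, wpTerm y N n) * (∑' n, wpTerm 0 0 n) * ratioProd y N ^ 2 * (2 * N + 1) * (1 + y) := by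
  induction N with
  | zero => simp [ratioProd]
  | succ N ih =>
    rw [tsum_wpTerm_succ hy hy1 N, tsum_wpTerm_succ le_rfl zero_le_one N] at ih
    rw [ratioProd, prod_range_succ, ← ratioProd]
    push_cast
    generalize (∑' n, wpTerm y 0 n) = a at *
    generalize (∑' n, wpTerm 0 0 n) = b at *
    generalize (∑' n, wpTerm y (N + 1) n) = c at *
    generalize (∑' n, wpTerm 0 (N + 1) n) = d at *
    generalize ratioProd y N = e at *
    have hN : (0 : ℝ) ≤ N := N.cast_nonneg
    linear_combination (norm := (field_simp; ring)) (2 * N + 3 + y) * ((2 * N + 3) ^ 3 * (2 * N + 1)) /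
      (4 * (2 + N) * (1 + N) * (2 * N + 2) ^ 2 * (2 * N + 1 + y)) * ih

theorem tendsto_ratioProd_sq {y : ℝ} (hy : 0 ≤ y) (hy1 : y ≤ 1) :
    Tendsto (fun N ↦ (∑' n : ℕ, 1 / (2 * (n : ℝ) + 1) ^ 2) * ratioProd y N ^ 2) atTop
      (𝓝 (∑' n : ℕ, oddProd y n / ((2 * n + 1) * (2 * n + 1 + y)))) := by
  have hy' : 1 + y ≠ 0 := by positivity
  have e1 : ∑' n, wpTerm y 0 n =
      (1 + y) * ∑' n : ℕ, oddProd y n / ((2 * n + 1) * (2 * n + 1 + y)) := by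
    simp_rw [wpTerm_zero_left hy, tsum_mul_left]
  have e2 : ∑' n, wpTerm 0 0 n = ∑' n : ℕ, 1 / (2 * (n : ℝ) + 1) ^ 2 := by
    refine tsum_congr fun n ↦ ?_
    rw [wpTerm_zero_left le_rfl, oddProd, prod_eq_one]
    · simp [pow_two]
    · intro i _
      simp only [sub_zero, add_zero]
      exact div_self (by positivity)
  have hlin : Tendsto (fun N : ℕ ↦ 1 + y / (2 * N + 1)) atTop (𝓝 1) := by
    have : Tendsto (fun N : ℕ ↦ 2 * (N : ℝ) + 1) atTop atTop :=
      tendsto_atTop_add_const_right _ _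
        (tendsto_natCast_atTop_atTop.const_mul_atTop (by norm_num))
    simpa using (this.const_div_atTop y).const_add 1
  have hl := ((tendsto_tsum_wpTerm le_rfl zero_le_one).div (tendsto_tsum_wpTerm hy hy1)
    one_ne_zero).mul hlin |>.const_mul
      (∑' n : ℕ, oddProd y n / ((2 * n + 1) * (2 * n + 1 + y)))
  simp only [div_one, mul_one] at hl
  refine hl.congr' (Eventually.of_forall fun N ↦ ?_)
  have h := tsum_wpTerm_zero_mul hy hy1 N
  have hpos : ∑' n, wpTerm y N n ≠ 0 := by
    refine ((summable_wpTerm hy hy1 N).tsum_pos (wpTerm_nonneg hy hy1 N) 0 ?_).ne'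
    simp [wpTerm]
  rw [e1, e2] at h
  simp only [Pi.div_apply]
  field_simp
  apply mul_left_cancel₀ hy'
  linear_combination h

/-- `∑_{j < 2n+1, j odd} 1 / j`. -/
noncomputable def oddHarm (n : ℕ) : ℝ := ∑ i ∈ range n, 1 / (2 * (i : ℝ) + 1)

theorem oddHarm_nonneg (n : ℕ) : 0 ≤ oddHarm n := sum_nonneg fun _ _ ↦ by positivity

theorem abs_oddProd_sub_le {y : ℝ} (hy : 0 ≤ y) (hy1 : y ≤ 1) (n : ℕ) :
    |oddProd y n - (1 - 2 * oddHarm n * y + 2 * oddHarm n ^ 2 * y ^ 2)| ≤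
      4 * (1 + oddHarm n) ^ 3 * y ^ 3 := by
  induction n with
  | zero =>
    simp only [oddProd, oddHarm, range_zero, prod_empty, sum_empty]
    norm_num
    positivity
  | succ n ih =>
    have hh := oddHarm_nonneg n
    have e1 : oddProd y (n + 1) = oddProd y n * ((2 * n + 1 - y) / (2 * n + 1 + y)) := by
      rw [oddProd, prod_range_succ, ← oddProd]
    have e2 : oddHarm (n + 1) = oddHarm n + 1 / (2 * (n : ℝ) + 1) := by
      rw [oddHarm, sum_range_succ, ← oddHarm]
    have hn : (0 : ℝ) ≤ n := n.cast_nonneg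
    rw [e1, e2]
    generalize oddProd y n = p at *
    generalize oddHarm n = h at *
    obtain ⟨w, hw⟩ : ∃ w : ℝ, w = 1 / (2 * (n : ℝ) + 1) := ⟨_, rfl⟩
    have hw0 : 0 ≤ w := by rw [hw]; positivity
    have hw1 : w ≤ 1 := by
      rw [hw, div_le_one (by positivity)]
      linarith
    have hq : (2 * n + 1 - y) / (2 * n + 1 + y) = (1 - w * y) / (1 + w * y) := by
      rw [hw]; field_simp
    rw [hq, ← hw]
    have hwy : w * y ≤ 1 := by nlinarith
    have hq0 : 0 ≤ (1 - w * y) / (1 + w * y) := div_nonneg (by linarith) (by positivity)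
    have hq1 : (1 - w * y) / (1 + w * y) ≤ 1 := by
      rw [div_le_one (by positivity)]
      nlinarith [mul_nonneg hw0 hy]
    have hid : p * ((1 - w * y) / (1 + w * y)) -
        (1 - 2 * (h + w) * y + 2 * (h + w) ^ 2 * y ^ 2) =
        (p - (1 - 2 * h * y + 2 * h ^ 2 * y ^ 2)) * ((1 - w * y) / (1 + w * y)) -
        (w * y ^ 3) * ((2 * w ^ 2 + 4 * h * w + 4 * h ^ 2) / (1 + w * y)) := by
      field_simp
      ring
    have hb0 : 0 ≤ (2 * w ^ 2 + 4 * h * w + 4 * h ^ 2) / (1 + w * y) := by positivity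
    have hb : (2 * w ^ 2 + 4 * h * w + 4 * h ^ 2) / (1 + w * y) ≤ 4 * (1 + h) ^ 2 := by
      rw [div_le_iff₀ (by positivity)]
      have : 2 * w ^ 2 + 4 * h * w + 4 * h ^ 2 ≤ 4 * (1 + h) ^ 2 := by nlinarith
      nlinarith [mul_nonneg (by positivity : 0 ≤ 4 * (1 + h) ^ 2) (mul_nonneg hw0 hy)]
    rw [hid]
    calc _ ≤ |p - (1 - 2 * h * y + 2 * h ^ 2 * y ^ 2)| * ((1 - w * y) / (1 + w * y)) +
          (w * y ^ 3) * ((2 * w ^ 2 + 4 * h * w + 4 * h ^ 2) / (1 + w * y)) := by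
          refine (abs_sub _ _).trans ?_
          rw [abs_mul, abs_of_nonneg hq0, abs_of_nonneg (mul_nonneg (by positivity) hb0)]
      _ ≤ 4 * (1 + h) ^ 3 * y ^ 3 * 1 + (w * y ^ 3) * (4 * (1 + h) ^ 2) := by gcongr
      _ ≤ 4 * (1 + (h + w)) ^ 3 * y ^ 3 := by
          have : 0 ≤ y ^ 3 * (8 * (1 + h) ^ 2 * w + 12 * (1 + h) * w ^ 2 + 4 * w ^ 3) := by
            positivity
          nlinarith

theorem abs_oddProd_div_sub_le {y : ℝ} (hy : 0 ≤ y) (hy1 : y ≤ 1) (n : ℕ) :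
    |oddProd y n / ((2 * n + 1) * (2 * n + 1 + y)) -
      (1 / (2 * (n : ℝ) + 1) ^ 2 -
        1 / (2 * (n : ℝ) + 1) ^ 2 * (1 / (2 * n + 1) + 2 * oddHarm n) * y +
        1 / (2 * (n : ℝ) + 1) ^ 2 * (1 / (2 * n + 1) ^ 2 + 2 * oddHarm n / (2 * n + 1) +
          2 * oddHarm n ^ 2) * y ^ 2)| ≤
      (1 + oddHarm n) ^ 3 / (2 * n + 1) ^ 2 * (6 * y ^ 3) := by
  have hh := oddHarm_nonneg n
  have hp := abs_oddProd_sub_le hy hy1 n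
  generalize oddProd y n = p at *
  generalize oddHarm n = h at *
  have hn : (0 : ℝ) ≤ n := n.cast_nonneg
  obtain ⟨w, hw⟩ : ∃ w : ℝ, w = 1 / (2 * (n : ℝ) + 1) := ⟨_, rfl⟩
  have hw0 : 0 ≤ w := by rw [hw]; positivity
  have hw1 : w ≤ 1 := by
    rw [hw, div_le_one (by positivity)]
    linarith
  have hm : (2 * (n : ℝ) + 1) = 1 / w := by rw [hw]; field_simp
  have hw2 : 0 < w := by rw [hw]; positivity
  rw [hm]
  have hid : p / (1 / w * (1 / w + y)) - (1 / (1 / w) ^ 2 -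
        1 / (1 / w) ^ 2 * (1 / (1 / w) + 2 * h) * y +
        1 / (1 / w) ^ 2 * (1 / (1 / w) ^ 2 + 2 * h / (1 / w) + 2 * h ^ 2) * y ^ 2) =
      w ^ 2 * (((p - (1 - 2 * h * y + 2 * h ^ 2 * y ^ 2)) -
        y ^ 3 * (w * (w ^ 2 + 2 * h * w + 2 * h ^ 2))) / (1 + w * y)) := by
    field_simp
    ring
  have hb : w * (w ^ 2 + 2 * h * w + 2 * h ^ 2) ≤ 2 * (1 + h) ^ 3 := by
    calc _ ≤ 1 * (1 ^ 2 + 2 * h * 1 + 2 * h ^ 2) := by gcongr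
      _ ≤ _ := by nlinarith [pow_nonneg hh 3]
  rw [hid, abs_mul, abs_of_nonneg (by positivity), abs_div,
    abs_of_nonneg (by positivity : 0 ≤ 1 + w * y)]
  calc _ ≤ w ^ 2 * |(p - (1 - 2 * h * y + 2 * h ^ 2 * y ^ 2)) -
        y ^ 3 * (w * (w ^ 2 + 2 * h * w + 2 * h ^ 2))| := by
        gcongr
        exact div_le_self (abs_nonneg _) (by nlinarith [mul_nonneg hw0 hy])
    _ ≤ w ^ 2 * (4 * (1 + h) ^ 3 * y ^ 3 + y ^ 3 * (2 * (1 + h) ^ 3)) := by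
        gcongr
        refine (abs_sub _ _).trans ?_
        rw [abs_of_nonneg (by positivity : 0 ≤ y ^ 3 * (w * (w ^ 2 + 2 * h * w + 2 * h ^ 2)))]
        gcongr
    _ = _ := by field_simp; ring

theorem oddHarm_le (n : ℕ) : 1 + oddHarm n ≤ 8 * (2 * (n : ℝ) + 1) ^ (1 / 6 : ℝ) := by
  have h1 : oddHarm n ≤ harmonic n := by
    rw [oddHarm, harmonic]
    push_cast
    refine sum_le_sum fun i _ ↦ ?_
    rw [one_div]
    gcongr
    have : (0 : ℝ) ≤ i := i.cast_nonneg
    linarith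
  have h2 := harmonic_le_one_add_log n
  have hn : (0 : ℝ) ≤ n := n.cast_nonneg
  have h3 : Real.log n ≤ Real.log (2 * n + 1) := by
    rcases Nat.eq_zero_or_pos n with rfl | hn'
    · simp
    · exact Real.log_le_log (by exact_mod_cast hn') (by linarith)
  have h4 := Real.log_le_rpow_div (by positivity : (0 : ℝ) ≤ 2 * n + 1)
    (by norm_num : (0 : ℝ) < 1 / 6)
  have h5 : 1 ≤ (2 * (n : ℝ) + 1) ^ (1 / 6 : ℝ) :=
    Real.one_le_rpow (by linarith) (by norm_num)
  linarith

theorem summable_oddHarm_cube : Summable fun n : ℕ ↦ (1 + oddHarm n) ^ 3 / (2 * (n : ℝ) + 1) ^ 2 := by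
  have hs : Summable fun n : ℕ ↦ 512 * (1 / (2 * (n : ℝ) + 1) ^ (3 / 2 : ℝ)) := by
    have := (Real.summable_one_div_nat_rpow (p := 3 / 2)).2 (by norm_num)
    simpa [Function.comp_def] using
      (this.comp_injective (i := fun n : ℕ ↦ 2 * n + 1) fun a b h ↦ by simpa using h).mul_left 512
  refine .of_nonneg_of_le (fun n ↦ ?_) (fun n ↦ ?_) hs
  · have := oddHarm_nonneg n
    positivity
  · have h0 := oddHarm_nonneg n
    have hm : (0 : ℝ) < 2 * n + 1 := by positivity
    calc _ ≤ (8 * (2 * (n : ℝ) + 1) ^ (1 / 6 : ℝ)) ^ 3 / (2 * n + 1) ^ 2 := by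
          gcongr
          exact oddHarm_le n
      _ = 512 * (1 / (2 * (n : ℝ) + 1) ^ (3 / 2 : ℝ)) := by
          rw [mul_pow, ← Real.rpow_natCast, ← Real.rpow_natCast, ← Real.rpow_natCast,
            ← Real.rpow_mul hm.le, mul_div_assoc, ← Real.rpow_sub hm,
            one_div ((2 * (n : ℝ) + 1) ^ (3 / 2 : ℝ)), ← Real.rpow_neg hm.le]
          norm_num

theorem summable_of_le_oddHarm_cube {f : ℕ → ℝ} (C : ℝ) (h0 : ∀ n, 0 ≤ f n)
    (h : ∀ n, f n ≤ C * ((1 + oddHarm n) ^ 3 / (2 * (n : ℝ) + 1) ^ 2)) : Summable f :=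
  .of_nonneg_of_le h0 h (summable_oddHarm_cube.mul_left C)

/-- Partial sums of the alternating harmonic series, grouped in pairs. -/
noncomputable def altSum (N : ℕ) : ℝ :=
  ∑ k ∈ range N, (1 / (2 * (k : ℝ) + 1) - 1 / (2 * k + 2))

/-- Partial sums of `∑ (-1)^(j-1) / j²`, grouped in pairs. -/
noncomputable def altSqSum (N : ℕ) : ℝ :=
  ∑ k ∈ range N, (1 / (2 * (k : ℝ) + 1) ^ 2 - 1 / (2 * (k : ℝ) + 2) ^ 2)

theorem altSum_nonneg (N : ℕ) : 0 ≤ altSum N := by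
  refine sum_nonneg fun k _ ↦ ?_
  rw [sub_nonneg]
  gcongr
  norm_num

theorem altSum_le_one (N : ℕ) : altSum N ≤ 1 := by
  have : altSum N ≤ 1 - 1 / (2 * N + 1) := by
    induction N with
    | zero => simp [altSum]
    | succ N ih =>
      rw [altSum, sum_range_succ, ← altSum]
      have : 1 / (2 * (N : ℝ) + 1) - 1 / (2 * N + 2) ≤
          1 / (2 * N + 1) - 1 / (2 * (N + 1 : ℕ) + 1) := by
        push_cast
        exact sub_le_sub_left (one_div_le_one_div_of_le (by positivity) (by linarith)) _
      linarith
  have h2 : (0 : ℝ) ≤ 1 / (2 * N + 1) := by positivity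
  linarith

theorem altSqSum_nonneg (N : ℕ) : 0 ≤ altSqSum N := by
  refine sum_nonneg fun k _ ↦ ?_
  rw [sub_nonneg]
  gcongr
  norm_num

theorem altSqSum_le (N : ℕ) : altSqSum N ≤ 2 := by
  have : altSqSum N ≤ 2 * altSum N := by
    rw [altSqSum, altSum, mul_sum]
    refine sum_le_sum fun k _ ↦ ?_
    have hk : (0 : ℝ) ≤ k := k.cast_nonneg
    have h1 : 1 / (2 * (k : ℝ) + 1) ≤ 1 := by
      rw [div_le_one (by positivity)]
      linarith
    have h2 : 1 / (2 * (k : ℝ) + 2) ≤ 1 / (2 * (k : ℝ) + 1) := by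
      gcongr
      norm_num
    rw [← one_div_pow, ← one_div_pow]
    nlinarith
  linarith [altSum_le_one N]

theorem abs_ratioProd_sub_le {y : ℝ} (hy : 0 ≤ y) (N : ℕ) :
    |ratioProd y N - (1 - altSum N * y + (altSum N ^ 2 + altSqSum N) / 2 * y ^ 2)| ≤
      8 * altSum N * y ^ 3 := by
  induction N with
  | zero => simp [ratioProd, altSum, altSqSum]
  | succ N ih =>
    have hA := altSum_nonneg N
    have hA1 := altSum_le_one N
    have hB := altSqSum_nonneg N
    have hB1 := altSqSum_le N
    have hN : (0 : ℝ) ≤ N := N.cast_nonneg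
    have e1 : altSum (N + 1) = altSum N + (1 / (2 * (N : ℝ) + 1) - 1 / (2 * N + 2)) := by
      rw [altSum, sum_range_succ, ← altSum]
    have e2 : altSqSum (N + 1) =
        altSqSum N + (1 / (2 * (N : ℝ) + 1) ^ 2 - 1 / (2 * (N : ℝ) + 2) ^ 2) := by
      rw [altSqSum, sum_range_succ, ← altSqSum]
    rw [ratioProd, prod_range_succ, ← ratioProd, e1, e2]
    generalize ratioProd y N = p at *
    generalize altSum N = A at *
    generalize altSqSum N = B at *
    obtain ⟨a, ha⟩ : ∃ a : ℝ, a = 1 / (2 * (N : ℝ) + 1) := ⟨_, rfl⟩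
    obtain ⟨b, hb⟩ : ∃ b : ℝ, b = 1 / (2 * (N : ℝ) + 2) := ⟨_, rfl⟩
    have ha0 : 0 ≤ a := by rw [ha]; positivity
    have hb0 : 0 ≤ b := by rw [hb]; positivity
    have ha1 : a ≤ 1 := by
      rw [ha, div_le_one (by positivity)]
      linarith
    have hba : b ≤ a := by
      rw [ha, hb]
      gcongr
      norm_num
    have hq : (2 * N + 2 + y) * (2 * N + 1) / ((2 * N + 2) * (2 * N + 1 + y)) =
        (1 + b * y) / (1 + a * y) := by
      rw [ha, hb]; field_simp
    rw [hq, ← one_div_pow, ← one_div_pow, ← ha, ← hb]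
    have hq0 : 0 ≤ (1 + b * y) / (1 + a * y) := by positivity
    have hq1 : (1 + b * y) / (1 + a * y) ≤ 1 := by
      rw [div_le_one (by positivity)]
      gcongr
    have hd : 0 ≤ a - b := by linarith
    have hay : 0 ≤ a * y := by positivity
    have hid : p * ((1 + b * y) / (1 + a * y)) - (1 - (A + (a - b)) * y +
          ((A + (a - b)) ^ 2 + (B + (a ^ 2 - b ^ 2))) / 2 * y ^ 2) =
        (p - (1 - A * y + (A ^ 2 + B) / 2 * y ^ 2)) * ((1 + b * y) / (1 + a * y)) -
        y ^ 3 * (a - b) * (((A ^ 2 + B) / 2 + a * (A + a)) / (1 + a * y)) := by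
      field_simp
      ring
    have hb0 : 0 ≤ ((A ^ 2 + B) / 2 + a * (A + a)) / (1 + a * y) := by positivity
    have hb : ((A ^ 2 + B) / 2 + a * (A + a)) / (1 + a * y) ≤ 8 := by
      refine (div_le_self (by positivity) (by linarith)).trans ?_
      nlinarith
    rw [hid]
    calc _ ≤ |p - (1 - A * y + (A ^ 2 + B) / 2 * y ^ 2)| * ((1 + b * y) / (1 + a * y)) +
        y ^ 3 * (a - b) * (((A ^ 2 + B) / 2 + a * (A + a)) / (1 + a * y)) := by
          refine (abs_sub _ _).trans ?_
          rw [abs_mul, abs_of_nonneg hq0, abs_of_nonneg (mul_nonneg (by positivity) hb0)]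
      _ ≤ 8 * A * y ^ 3 * 1 + y ^ 3 * (a - b) * 8 := by gcongr
      _ = _ := by ring

theorem ratioProd_mem {y : ℝ} (hy : 0 ≤ y) (N : ℕ) : 0 ≤ ratioProd y N ∧ ratioProd y N ≤ 1 := by
  refine ⟨prod_nonneg fun i _ ↦ by positivity, prod_le_one (fun i _ ↦ by positivity) fun i _ ↦ ?_⟩
  rw [div_le_one (by positivity)]
  nlinarith

theorem abs_ratioProd_sq_sub_le {y : ℝ} (hy : 0 ≤ y) (hy1 : y ≤ 1) (N : ℕ) :
    |ratioProd y N ^ 2 - (1 - 2 * altSum N * y + (2 * altSum N ^ 2 + altSqSum N) * y ^ 2)| ≤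
      50 * y ^ 3 := by
  have hA := altSum_nonneg N
  have hA1 := altSum_le_one N
  have hB := altSqSum_nonneg N
  have hB1 := altSqSum_le N
  have hE := abs_ratioProd_sub_le hy N
  obtain ⟨hp0, hp1⟩ := ratioProd_mem hy N
  generalize ratioProd y N = p at *
  generalize altSum N = A at *
  generalize altSqSum N = B at *
  obtain ⟨T, hT⟩ : ∃ T, T = 1 - A * y + (A ^ 2 + B) / 2 * y ^ 2 := ⟨_, rfl⟩
  rw [← hT] at hE
  have hAA : A ^ 2 ≤ 1 := by nlinarith
  have hAy : 0 ≤ A * y ∧ A * y ≤ 1 := ⟨by positivity, by nlinarith⟩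
  have hyy : y ^ 2 ≤ 1 := by nlinarith
  have hC : 0 ≤ (A ^ 2 + B) / 2 * y ^ 2 ∧ (A ^ 2 + B) / 2 * y ^ 2 ≤ 2 := by
    refine ⟨by positivity, ?_⟩
    calc _ ≤ (1 + 2) / 2 * (1 : ℝ) := by gcongr
      _ ≤ 2 := by norm_num
  have hid : p ^ 2 - (1 - 2 * A * y + (2 * A ^ 2 + B) * y ^ 2) =
      (p - T) * (p + T) + y ^ 3 * (-(A * (A ^ 2 + B)) + ((A ^ 2 + B) / 2) ^ 2 * y) := by
    rw [hT]; ring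
  have h1 : |p + T| ≤ 4 := abs_le.2 ⟨by linarith, by linarith⟩
  have h2 : |-(A * (A ^ 2 + B)) + ((A ^ 2 + B) / 2) ^ 2 * y| ≤ 6 := by
    have h3 : 0 ≤ A * (A ^ 2 + B) ∧ A * (A ^ 2 + B) ≤ 3 := by
      refine ⟨by positivity, ?_⟩
      calc _ ≤ 1 * ((1 : ℝ) + 2) := by gcongr
        _ = 3 := by norm_num
    have h4 : 0 ≤ ((A ^ 2 + B) / 2) ^ 2 * y ∧ ((A ^ 2 + B) / 2) ^ 2 * y ≤ 3 := by
      refine ⟨by positivity, ?_⟩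
      calc _ ≤ ((1 + 2) / 2) ^ 2 * (1 : ℝ) := by gcongr
        _ ≤ 3 := by norm_num
    exact abs_le.2 ⟨by linarith, by linarith⟩
  have hy3 : 0 ≤ y ^ 3 := by positivity
  rw [hid]
  calc _ ≤ |p - T| * |p + T| + y ^ 3 * |-(A * (A ^ 2 + B)) + ((A ^ 2 + B) / 2) ^ 2 * y| := by
        refine (abs_add_le _ _).trans ?_
        rw [abs_mul, abs_mul, abs_of_nonneg hy3]
    _ ≤ (8 * 1 * y ^ 3) * 4 + y ^ 3 * 6 := by
        gcongr
        exact hE.trans (by gcongr)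
    _ ≤ 50 * y ^ 3 := by linarith

theorem tendsto_altSum : Tendsto altSum atTop (𝓝 (Real.log 2)) := by
  have hA (N : ℕ) : altSum N = harmonic (2 * N) - harmonic N := by
    induction N with
    | zero => simp [altSum]
    | succ N ih =>
      rw [altSum, sum_range_succ, ← altSum, ih, show 2 * (N + 1) = 2 * N + 1 + 1 by ring,
        harmonic_succ, harmonic_succ, harmonic_succ]
      push_cast
      field_simp
      ring
  have h1 := Real.tendsto_harmonic_sub_log
  have h2 : Tendsto (fun N : ℕ ↦ 2 * N) atTop atTop :=
    tendsto_id.const_mul_atTop' (by norm_num)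
  have h3 := ((h1.comp h2).sub h1).add_const (Real.log 2)
  rw [sub_self, zero_add] at h3
  refine h3.congr' ?_
  filter_upwards [eventually_gt_atTop 0] with N hN
  have hN' : (N : ℝ) ≠ 0 := by positivity
  simp only [Function.comp_apply, hA]
  push_cast
  rw [Real.log_mul two_ne_zero hN']
  ring

theorem tendsto_altSqSum :
    Tendsto altSqSum atTop (𝓝 (2 / 3 * ∑' n : ℕ, 1 / (2 * (n : ℝ) + 1) ^ 2)) := by
  have hz : Summable fun n : ℕ ↦ 1 / ((n : ℝ) + 1) ^ 2 := by
    have := (Real.summable_one_div_nat_pow (p := 2)).2 (by norm_num)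
    simpa using (summable_nat_add_iff 1).2 this
  have he : (fun n : ℕ ↦ 1 / (2 * (n : ℝ) + 2) ^ 2) = fun n : ℕ ↦ 1 / 4 * (1 / ((n : ℝ) + 1) ^ 2) := by
    funext n
    field_simp
    ring
  have hze : Summable fun n : ℕ ↦ 1 / (2 * (n : ℝ) + 2) ^ 2 := he ▸ hz.mul_left _
  have h1 : ∑' n : ℕ, 1 / (2 * (n : ℝ) + 2) ^ 2 = 1 / 4 * ∑' n : ℕ, 1 / ((n : ℝ) + 1) ^ 2 := by
    rw [he, tsum_mul_left]
  have h2 : ∑' n : ℕ, 1 / (2 * (n : ℝ) + 1) ^ 2 + ∑' n : ℕ, 1 / (2 * (n : ℝ) + 2) ^ 2 =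
      ∑' n : ℕ, 1 / ((n : ℝ) + 1) ^ 2 := by
    have := tsum_even_add_odd (f := fun n : ℕ ↦ 1 / ((n : ℝ) + 1) ^ 2)
      (by simpa using summable_odd_sq) (by simpa [add_assoc, one_add_one_eq_two] using hze)
    simpa [add_assoc, one_add_one_eq_two] using this
  have h3 := (summable_odd_sq.hasSum.sub hze.hasSum).tendsto_sum_nat
  have h4 : 2 / 3 * ∑' n : ℕ, 1 / (2 * (n : ℝ) + 1) ^ 2 =
      ∑' n : ℕ, 1 / (2 * (n : ℝ) + 1) ^ 2 - ∑' n : ℕ, 1 / (2 * (n : ℝ) + 2) ^ 2 := by linarith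
  rw [h4]
  exact h3

theorem eq_zero_of_abs_quadratic_le {a b c K : ℝ}
    (h : ∀ y, 0 < y → y ≤ 1 → |a + b * y + c * y ^ 2| ≤ K * y ^ 3) : c = 0 := by
  have main {f g : ℝ → ℝ} (hf : Continuous f) (hg : Continuous g) (hg0 : g 0 = 0)
      (hfg : ∀ y, 0 < y → y ≤ 1 → |f y| ≤ g y) : f 0 = 0 := by
    have hf' : Tendsto f (𝓝[>] 0) (𝓝 (f 0)) := hf.continuousWithinAt
    have hg' : Tendsto g (𝓝[>] 0) (𝓝 (g 0)) := hg.continuousWithinAt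
    rw [hg0] at hg'
    refine tendsto_nhds_unique hf' (squeeze_zero_norm' ?_ hg')
    filter_upwards [Ioc_mem_nhdsGT (zero_lt_one' ℝ)] with y hy using hfg y hy.1 hy.2
  have ha : a = 0 := by
    simpa using main (f := fun y ↦ a + b * y + c * y ^ 2) (g := fun y ↦ K * y ^ 3)
      (by fun_prop) (by fun_prop) (by simp) h
  subst ha
  have hb : b = 0 := by
    simpa using main (f := fun y ↦ b + c * y) (g := fun y ↦ K * y ^ 2)
      (by fun_prop) (by fun_prop) (by simp) fun y hy hy1 ↦ by
        have := h y hy hy1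
        rw [show 0 + b * y + c * y ^ 2 = y * (b + c * y) by ring, abs_mul, abs_of_pos hy,
          show K * y ^ 3 = y * (K * y ^ 2) by ring] at this
        exact le_of_mul_le_mul_left this hy
  subst hb
  simpa using main (f := fun _ ↦ c) (g := fun y ↦ K * y)
    (by fun_prop) (by fun_prop) (by simp) fun y hy hy1 ↦ by
      have := h y hy hy1
      rw [show 0 + 0 * y + c * y ^ 2 = y ^ 2 * c by ring, abs_mul, abs_of_pos (by positivity),
        show K * y ^ 3 = y ^ 2 * (K * y) by ring] at this
      exact le_of_mul_le_mul_left this (by positivity)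

theorem tsum_sq_coeff :
    ∑' n : ℕ, 1 / (2 * (n : ℝ) + 1) ^ 2 *
        (1 / (2 * n + 1) ^ 2 + 2 * oddHarm n / (2 * n + 1) + 2 * oddHarm n ^ 2) =
      (∑' n : ℕ, 1 / (2 * (n : ℝ) + 1) ^ 2) *
        (2 * Real.log 2 ^ 2 + 2 / 3 * ∑' n : ℕ, 1 / (2 * (n : ℝ) + 1) ^ 2) := by
  set t : ℝ := ∑' n : ℕ, 1 / (2 * (n : ℝ) + 1) ^ 2 with ht
  have ht0 : 0 ≤ t := tsum_nonneg fun n ↦ by positivity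
  have hw (n : ℕ) : 0 ≤ 1 / (2 * (n : ℝ) + 1) ∧ 1 / (2 * (n : ℝ) + 1) ≤ 1 := by
    refine ⟨by positivity, ?_⟩
    rw [div_le_one (by positivity)]
    have : (0 : ℝ) ≤ n := n.cast_nonneg
    linarith
  have hs1 : Summable fun n : ℕ ↦ 1 / (2 * (n : ℝ) + 1) ^ 2 * (1 / (2 * n + 1) + 2 * oddHarm n) := by
    refine summable_of_le_oddHarm_cube 2 (fun n ↦ ?_) fun n ↦ ?_
    · have := oddHarm_nonneg n
      positivity
    · have h0 := oddHarm_nonneg n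
      calc _ ≤ 1 / (2 * (n : ℝ) + 1) ^ 2 * (2 * (1 + oddHarm n) ^ 3) := by
            gcongr
            nlinarith [(hw n).2, pow_nonneg h0 3, pow_nonneg h0 2]
        _ = _ := by ring
  have hs2 : Summable fun n : ℕ ↦ 1 / (2 * (n : ℝ) + 1) ^ 2 *
        (1 / (2 * n + 1) ^ 2 + 2 * oddHarm n / (2 * n + 1) + 2 * oddHarm n ^ 2) := by
    refine summable_of_le_oddHarm_cube 2 (fun n ↦ ?_) fun n ↦ ?_
    · have := oddHarm_nonneg n
      positivity
    · have h0 := oddHarm_nonneg n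
      have h1 : (1 / (2 * (n : ℝ) + 1)) ^ 2 ≤ 1 := pow_le_one₀ (hw n).1 (hw n).2
      have h2 : 2 * oddHarm n * (1 / (2 * (n : ℝ) + 1)) ≤ 2 * oddHarm n :=
        mul_le_of_le_one_right (by positivity) (hw n).2
      calc _ ≤ 1 / (2 * (n : ℝ) + 1) ^ 2 * (2 * (1 + oddHarm n) ^ 3) := by
            gcongr
            rw [div_eq_mul_one_div (2 * oddHarm n), ← one_div_pow]
            nlinarith [pow_nonneg h0 3, pow_nonneg h0 2]
        _ = _ := by ring
  have hexp {y : ℝ} (hy : 0 < y) (hy1 : y ≤ 1) :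
      |(∑' n : ℕ, oddProd y n / ((2 * n + 1) * (2 * n + 1 + y))) -
        (t - (∑' n : ℕ, 1 / (2 * (n : ℝ) + 1) ^ 2 * (1 / (2 * n + 1) + 2 * oddHarm n)) * y +
        (∑' n : ℕ, 1 / (2 * (n : ℝ) + 1) ^ 2 *
        (1 / (2 * n + 1) ^ 2 + 2 * oddHarm n / (2 * n + 1) + 2 * oddHarm n ^ 2)) * y ^ 2)| ≤
      (∑' n : ℕ, (1 + oddHarm n) ^ 3 / (2 * (n : ℝ) + 1) ^ 2) * (6 * y ^ 3) := by
    have hP := (summable_odd_sq.sub (hs1.mul_right y)).add (hs2.mul_right (y ^ 2))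
    have hb := summable_oddHarm_cube.mul_right (6 * y ^ 3)
    have hd : Summable fun n : ℕ ↦ oddProd y n / ((2 * n + 1) * (2 * n + 1 + y)) -
      (1 / (2 * (n : ℝ) + 1) ^ 2 -
        1 / (2 * (n : ℝ) + 1) ^ 2 * (1 / (2 * n + 1) + 2 * oddHarm n) * y +
        1 / (2 * (n : ℝ) + 1) ^ 2 * (1 / (2 * n + 1) ^ 2 + 2 * oddHarm n / (2 * n + 1) +
          2 * oddHarm n ^ 2) * y ^ 2) :=
      .of_norm_bounded hb fun n ↦ abs_oddProd_div_sub_le hy.le hy1 n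
    have hF : Summable fun n : ℕ ↦ oddProd y n / ((2 * n + 1) * (2 * n + 1 + y)) := by
      simpa using hd.add hP
    rw [ht, ← tsum_mul_right, ← tsum_mul_right, ← summable_odd_sq.tsum_sub (hs1.mul_right y),
      ← (summable_odd_sq.sub (hs1.mul_right y)).tsum_add (hs2.mul_right (y ^ 2)),
      ← hF.tsum_sub hP, ← tsum_mul_right, ← Real.norm_eq_abs]
    exact tsum_of_norm_bounded hb.hasSum fun n ↦ abs_oddProd_div_sub_le hy.le hy1 n
  have hprod {y : ℝ} (hy : 0 < y) (hy1 : y ≤ 1) :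
      |(∑' n : ℕ, oddProd y n / ((2 * n + 1) * (2 * n + 1 + y))) -
        t * (1 - 2 * Real.log 2 * y + (2 * Real.log 2 ^ 2 + 2 / 3 * t) * y ^ 2)| ≤
      t * (50 * y ^ 3) := by
    have hT : Tendsto (fun N ↦ t * (1 - 2 * altSum N * y +
        (2 * altSum N ^ 2 + altSqSum N) * y ^ 2)) atTop
        (𝓝 (t * (1 - 2 * Real.log 2 * y + (2 * Real.log 2 ^ 2 + 2 / 3 * t) * y ^ 2))) :=
      ((((tendsto_altSum.const_mul 2).mul_const y).const_sub 1).add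
        ((((tendsto_altSum.pow 2).const_mul 2).add tendsto_altSqSum).mul_const _)).const_mul t
    refine le_of_tendsto ((tendsto_ratioProd_sq hy.le hy1).sub hT).abs
      (Eventually.of_forall fun N ↦ ?_)
    rw [← mul_sub, abs_mul, abs_of_nonneg ht0]
    gcongr
    exact abs_ratioProd_sq_sub_le hy.le hy1 N
  generalize (∑' n : ℕ, 1 / (2 * (n : ℝ) + 1) ^ 2 * (1 / (2 * n + 1) + 2 * oddHarm n)) = S₁ at *
  generalize (∑' n : ℕ, 1 / (2 * (n : ℝ) + 1) ^ 2 *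
        (1 / (2 * n + 1) ^ 2 + 2 * oddHarm n / (2 * n + 1) + 2 * oddHarm n ^ 2)) = S₂ at *
  generalize (∑' n : ℕ, (1 + oddHarm n) ^ 3 / (2 * (n : ℝ) + 1) ^ 2) = K at *
  refine sub_eq_zero.1 (eq_zero_of_abs_quadratic_le (a := 0) (b := 2 * Real.log 2 * t - S₁)
    (K := 50 * t + 6 * K) fun y hy hy1 ↦ ?_)
  have h1 := abs_le.1 (hexp hy hy1)
  have h2 := abs_le.1 (hprod hy hy1)
  refine abs_le.2 ⟨?_, ?_⟩ <;> linarith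

theorem tv_one (a : ℕ) : tv 2 1 [a] = ∑' n : ℕ, ((2 * (n : ℝ) + 1) ^ a)⁻¹ := by
  let e : ℕ → {f : Fin [a].length → ℕ // StrictAnti f ∧ ∀ i, 0 < f i ∧ f i % 2 = 1 % 2} :=
    fun n ↦ ⟨fun _ ↦ 2 * n + 1, fun (i j : Fin 1) h ↦ absurd h (by simp [Subsingleton.elim i j]),
      fun _ ↦ by dsimp only; omega⟩
  have he : e.Bijective := by
    constructor
    · intro n n' h
      have h0 := congrFun (congrArg Subtype.val h) (0 : Fin 1)
      simp only [e] at h0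
      omega
    · rintro ⟨f, hf, hf2⟩
      refine ⟨f (0 : Fin 1) / 2, Subtype.ext (funext fun i : Fin 1 ↦ ?_)⟩
      have := hf2 (0 : Fin 1)
      fin_cases i
      simp only [e, Fin.zero_eta]
      omega
  rw [tv, ← (Equiv.ofBijective e he).tsum_eq]
  refine tsum_congr fun n ↦ ?_
  change ∏ i : Fin 1, _ = _
  simp [e]

theorem tv_two (a b : ℕ) : tv 2 1 [a, b] =
    ∑' x : Σ n : ℕ, Fin n, ((2 * (x.1 : ℝ) + 1) ^ a)⁻¹ * ((2 * (x.2 : ℝ) + 1) ^ b)⁻¹ := by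
  let e : (Σ n : ℕ, Fin n) →
      {f : Fin [a, b].length → ℕ // StrictAnti f ∧ ∀ i, 0 < f i ∧ f i % 2 = 1 % 2} :=
    fun x ↦ ⟨(![2 * x.1 + 1, 2 * x.2 + 1] : Fin 2 → ℕ), by
      refine Fin.strictAnti_iff_succ_lt (n := 1).2 fun i ↦ ?_
      have := x.2.2
      fin_cases i
      simp, fun i ↦ by
      change Fin 2 at i
      fin_cases i <;> simp⟩
  have he : e.Bijective := by
    constructor
    · rintro ⟨n, i⟩ ⟨n', i'⟩ h
      have h0 := congrFun (congrArg Subtype.val h) (0 : Fin 2)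
      have h1 := congrFun (congrArg Subtype.val h) (1 : Fin 2)
      simp [e] at h0 h1
      subst h0
      obtain rfl := Fin.ext h1
      rfl
    · rintro ⟨f, hf, hf2⟩
      have h0 := hf2 (0 : Fin 2)
      have h1 := hf2 (1 : Fin 2)
      have h01 : f (1 : Fin 2) < f (0 : Fin 2) := hf (show (0 : Fin 2) < 1 by decide)
      refine ⟨⟨f (0 : Fin 2) / 2, ⟨f (1 : Fin 2) / 2, by omega⟩⟩,
        Subtype.ext (funext fun i : Fin 2 ↦ ?_)⟩
      fin_cases i <;> simp [e] <;> omega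
  rw [tv, ← (Equiv.ofBijective e he).tsum_eq]
  refine tsum_congr fun n ↦ ?_
  change ∏ i : Fin 2, _ = _
  simp [e, Fin.prod_univ_two]
  ring

theorem tv_three (a b c : ℕ) : tv 2 1 [a, b, c] =
    ∑' x : Σ n : ℕ, Σ i : Fin n, Fin i, ((2 * (x.1 : ℝ) + 1) ^ a)⁻¹ *
      (((2 * (x.2.1 : ℝ) + 1) ^ b)⁻¹ * ((2 * (x.2.2 : ℝ) + 1) ^ c)⁻¹) := by
  let e : (Σ n : ℕ, Σ i : Fin n, Fin i) →
      {f : Fin [a, b, c].length → ℕ // StrictAnti f ∧ ∀ i, 0 < f i ∧ f i % 2 = 1 % 2} :=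
    fun x ↦ ⟨(![2 * x.1 + 1, 2 * x.2.1 + 1, 2 * x.2.2 + 1] : Fin 3 → ℕ), by
      refine Fin.strictAnti_iff_succ_lt (n := 2).2 fun i ↦ ?_
      have := x.2.1.2
      have := x.2.2.2
      fin_cases i <;> simp, fun i ↦ by
      change Fin 3 at i
      fin_cases i <;> simp⟩
  have he : e.Bijective := by
    constructor
    · rintro ⟨n, i, l⟩ ⟨n', i', l'⟩ h
      have h0 := congrFun (congrArg Subtype.val h) (0 : Fin 3)
      have h1 := congrFun (congrArg Subtype.val h) (1 : Fin 3)
      have h2 := congrFun (congrArg Subtype.val h) (2 : Fin 3)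
      simp [e] at h0 h1 h2
      subst h0
      obtain rfl := Fin.ext h1
      obtain rfl := Fin.ext h2
      rfl
    · rintro ⟨f, hf, hf2⟩
      have h0 := hf2 (0 : Fin 3)
      have h1 := hf2 (1 : Fin 3)
      have h2 := hf2 (2 : Fin 3)
      have h01 : f (1 : Fin 3) < f (0 : Fin 3) := hf (show (0 : Fin 3) < 1 by decide)
      have h12 : f (2 : Fin 3) < f (1 : Fin 3) := hf (show (1 : Fin 3) < 2 by decide)
      refine ⟨⟨f (0 : Fin 3) / 2, ⟨f (1 : Fin 3) / 2, by omega⟩, ⟨f (2 : Fin 3) / 2, by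
        simp only; omega⟩⟩, Subtype.ext (funext fun i : Fin 3 ↦ ?_)⟩
      fin_cases i <;> simp [e] <;> omega
  rw [tv, ← (Equiv.ofBijective e he).tsum_eq]
  refine tsum_congr fun n ↦ ?_
  change ∏ i : Fin 3, _ = _
  simp [e, Fin.prod_univ_three]
  ring

/-- A nonnegative series over a sigma type with finite fibres, summed fibrewise. -/
theorem tsum_sigma_fintype {β : ℕ → Type*} [∀ n, Fintype (β n)] {f : (Σ n, β n) → ℝ}
    (hf : ∀ x, 0 ≤ f x) (hs : Summable fun n ↦ ∑ b, f ⟨n, b⟩) :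
    ∑' x, f x = ∑' n, ∑ b, f ⟨n, b⟩ := by
  have : Summable f := (summable_sigma_of_nonneg hf).2
    ⟨fun n ↦ (hasSum_fintype _).summable, by simpa only [tsum_fintype] using hs⟩
  rw [this.tsum_sigma]
  simp only [tsum_fintype]

theorem sq_oddHarm (n : ℕ) : oddHarm n ^ 2 = ∑ i : Fin n, ((2 * (i : ℝ) + 1) ^ 2)⁻¹ +
    2 * ∑ i : Fin n, (2 * (i : ℝ) + 1)⁻¹ * oddHarm i := by
  rw [Fin.sum_univ_eq_sum_range (fun i ↦ ((2 * (i : ℝ) + 1) ^ 2)⁻¹) n,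
    Fin.sum_univ_eq_sum_range (fun i ↦ (2 * (i : ℝ) + 1)⁻¹ * oddHarm i) n]
  induction n with
  | zero => simp [oddHarm]
  | succ n ih =>
    rw [oddHarm, sum_range_succ, ← oddHarm, sum_range_succ, sum_range_succ, add_sq, ih]
    field_simp
    ring

theorem oddHarm_eq_sum_fin (n : ℕ) : oddHarm n = ∑ i : Fin n, (2 * (i : ℝ) + 1)⁻¹ := by
  rw [Fin.sum_univ_eq_sum_range (fun i ↦ (2 * (i : ℝ) + 1)⁻¹) n, oddHarm]
  simp

theorem weighted_tv_eq_tsum :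
    tv 2 1 [4] + 2 * (tv 2 1 [3, 1] + tv 2 1 [2, 2]) + 4 * tv 2 1 [2, 1, 1] =
      ∑' n : ℕ, 1 / (2 * (n : ℝ) + 1) ^ 2 *
        (1 / (2 * n + 1) ^ 2 + 2 * oddHarm n / (2 * n + 1) + 2 * oddHarm n ^ 2) := by
  have hw (n : ℕ) : 0 ≤ (2 * (n : ℝ) + 1)⁻¹ ∧ (2 * (n : ℝ) + 1)⁻¹ ≤ 1 := by
    refine ⟨by positivity, inv_le_one_of_one_le₀ ?_⟩
    have : (0 : ℝ) ≤ n := n.cast_nonneg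
    linarith
  have hs {f : ℕ → ℝ} (h0 : ∀ n, 0 ≤ f n) (h : ∀ n, f n ≤ (1 + oddHarm n) ^ 3) :
      Summable fun n : ℕ ↦ ((2 * (n : ℝ) + 1) ^ 2)⁻¹ * f n := by
    refine summable_of_le_oddHarm_cube 1 (fun n ↦ mul_nonneg (by positivity) (h0 n)) fun n ↦ ?_
    rw [one_mul, div_eq_inv_mul]
    gcongr
    exact h n
  have hcube (n : ℕ) : 1 + oddHarm n + oddHarm n ^ 2 ≤ (1 + oddHarm n) ^ 3 := by
    have := oddHarm_nonneg n
    nlinarith [pow_nonneg this 2, pow_nonneg this 3]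
  have hsq (n : ℕ) : 0 ≤ ∑ i : Fin n, ((2 * (i : ℝ) + 1) ^ 2)⁻¹ :=
    sum_nonneg fun _ _ ↦ by positivity
  have htri (n : ℕ) : 0 ≤ ∑ i : Fin n, (2 * (i : ℝ) + 1)⁻¹ * oddHarm i :=
    sum_nonneg fun i _ ↦ mul_nonneg (by positivity) (oddHarm_nonneg i)
  have s4 : Summable fun n : ℕ ↦ ((2 * (n : ℝ) + 1) ^ 2)⁻¹ * (2 * (n : ℝ) + 1)⁻¹ ^ 2 :=
    hs (fun n ↦ by positivity) fun n ↦ by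
      have := oddHarm_nonneg n
      have := pow_le_one₀ (n := 2) (hw n).1 (hw n).2
      nlinarith [hcube n]
  have s31 : Summable fun n : ℕ ↦ ((2 * (n : ℝ) + 1) ^ 2)⁻¹ * ((2 * (n : ℝ) + 1)⁻¹ * oddHarm n) :=
    hs (fun n ↦ mul_nonneg (hw n).1 (oddHarm_nonneg n)) fun n ↦ by
      have := oddHarm_nonneg n
      have := mul_le_of_le_one_left this (hw n).2
      nlinarith [hcube n]
  have s22 : Summable fun n : ℕ ↦ ((2 * (n : ℝ) + 1) ^ 2)⁻¹ *
      ∑ i : Fin n, ((2 * (i : ℝ) + 1) ^ 2)⁻¹ :=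
    hs hsq fun n ↦ by
      linarith [hcube n, oddHarm_nonneg n, sq_oddHarm n, htri n]
  have s211 : Summable fun n : ℕ ↦ ((2 * (n : ℝ) + 1) ^ 2)⁻¹ *
      ∑ i : Fin n, (2 * (i : ℝ) + 1)⁻¹ * oddHarm i :=
    hs htri fun n ↦ by
      linarith [hcube n, oddHarm_nonneg n, sq_oddHarm n, hsq n, htri n]
  have e4 : tv 2 1 [4] = ∑' n : ℕ, ((2 * (n : ℝ) + 1) ^ 2)⁻¹ * (2 * (n : ℝ) + 1)⁻¹ ^ 2 := by
    rw [tv_one]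
    refine tsum_congr fun n ↦ ?_
    field_simp
  have f31 (n : ℕ) : ∑ i : Fin n, ((2 * (n : ℝ) + 1) ^ 3)⁻¹ * ((2 * (i : ℝ) + 1) ^ 1)⁻¹ =
      ((2 * (n : ℝ) + 1) ^ 2)⁻¹ * ((2 * (n : ℝ) + 1)⁻¹ * oddHarm n) := by
    rw [oddHarm_eq_sum_fin, ← mul_sum, ← mul_assoc]
    simp only [pow_one]
    field_simp
  have e31 : tv 2 1 [3, 1] =
      ∑' n : ℕ, ((2 * (n : ℝ) + 1) ^ 2)⁻¹ * ((2 * (n : ℝ) + 1)⁻¹ * oddHarm n) := by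
    rw [tv_two, tsum_sigma_fintype (fun x ↦ by positivity)] <;> simp only [f31]
    exact s31
  have e22 : tv 2 1 [2, 2] =
      ∑' n : ℕ, ((2 * (n : ℝ) + 1) ^ 2)⁻¹ * ∑ i : Fin n, ((2 * (i : ℝ) + 1) ^ 2)⁻¹ := by
    rw [tv_two, tsum_sigma_fintype (fun x ↦ by positivity)] <;> simp only [← mul_sum]
    exact s22
  have f211 (n : ℕ) : ∑ x : Σ i : Fin n, Fin i, ((2 * (n : ℝ) + 1) ^ 2)⁻¹ *
      (((2 * (x.1 : ℝ) + 1) ^ 1)⁻¹ * ((2 * (x.2 : ℝ) + 1) ^ 1)⁻¹) =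
      ((2 * (n : ℝ) + 1) ^ 2)⁻¹ * ∑ i : Fin n, (2 * (i : ℝ) + 1)⁻¹ * oddHarm i := by
    simp only [← mul_sum, Fintype.sum_sigma, pow_one, oddHarm_eq_sum_fin]
  have e211 : tv 2 1 [2, 1, 1] =
      ∑' n : ℕ, ((2 * (n : ℝ) + 1) ^ 2)⁻¹ * ∑ i : Fin n, (2 * (i : ℝ) + 1)⁻¹ * oddHarm i := by
    rw [tv_three, tsum_sigma_fintype (fun x ↦ by positivity)] <;> simp only [f211]
    exact s211
  rw [e4, e31, e22, e211, ← s31.tsum_add s22, ← tsum_mul_left, ← tsum_mul_left,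
    ← s4.tsum_add ((s31.add s22).mul_left 2),
    ← (s4.add ((s31.add s22).mul_left 2)).tsum_add (s211.mul_left 4)]
  refine tsum_congr fun n ↦ ?_
  rw [sq_oddHarm]
  field_simp
  ring

end

/-- Weighted sum formula in weight 4 for multiple t-values:
`t(4) + 2(t(3,1) + t(2,2)) + 4t(2,1,1) = (2/3)t(2)² + 2t(2)log²2`. -/
theorem stmt11 :
    tv 2 1 [4] + 2 * (tv 2 1 [3, 1] + tv 2 1 [2, 2]) + 4 * tv 2 1 [2, 1, 1] =
      2 / 3 * tv 2 1 [2] ^ 2 + 2 * tv 2 1 [2] * Real.log 2 ^ 2 := by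
  have h : tv 2 1 [2] = ∑' n : ℕ, 1 / (2 * (n : ℝ) + 1) ^ 2 := by simp [tv_one]
  rw [weighted_tv_eq_tsum, tsum_sq_coeff, h]
  ring
end

section
/- Let N be a positive integer, let a be an integer with 1 ≤ a ≤ N, let r be a real number, and let k, n, s be integers with k ≥ n+s and n ≥ s ≥ 1. Then for real z with 0 < z < 1, the function z ↦ X₀^r(k,n,s;z) is differentiable and (d/dz)X₀^r(k,n,s;z) = (1/z)[X^r(k−1,n,s−1;z) + X₀^r(k−1,n,s;z) − X₀^r(k−1,n,s−1;z)]. -/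
/-- All groupings of an index obtained by replacing each box in
`k₁ □ k₂ □ ⋯ □ kₙ` by a comma (new block) or a plus (merge). -/
def groupings : List ℕ → List (List ℕ)
  | [] => [[]]
  | [x] => [[x]]
  | x :: y :: rest => ((groupings (y :: rest)).map (x :: ·)) ++ groupings ((x + y) :: rest)
termination_by l => l.length

/-- The one-variable function
`L_{N,a}(k; z) = Σ_{m₁ > ⋯ > mₙ > 0, mᵢ ≡ a (mod N)} z^{m₁}/(m₁^{k₁} ⋯ mₙ^{kₙ})`. -/
noncomputable def Lv (N a : ℕ) (k : List ℕ) (z : ℝ) : ℝ :=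
  ∑' m : {f : Fin k.length → ℕ // StrictAnti f ∧ ∀ i, 0 < f i ∧ f i % N = a % N},
    (if h : 0 < k.length then z ^ (m.1 ⟨0, h⟩) else 1) *
      ∏ i : Fin k.length, ((m.1 i : ℝ) ^ k.get i)⁻¹

/-- The interpolated function `L^r_{N,a}(k; z) = Σ_p r^{n - dep(p)} L_{N,a}(p; z)`
over all groupings `p` of `k`. -/
noncomputable def iLv (N a : ℕ) (r : ℝ) (k : List ℕ) (z : ℝ) : ℝ :=
  ((groupings k).map (fun p => r ^ (k.length - p.length) * Lv N a p z)).sum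

/-- An index is admissible if all entries are positive and the first entry is at least `2`. -/
def IsAdmissible (k : List ℕ) : Prop := (∀ i ∈ k, 1 ≤ i) ∧ 2 ≤ k.headI

/-- The height of an index: the number of entries that are at least `2`. -/
def height (k : List ℕ) : ℕ := k.countP (fun i => 2 ≤ i)

/-- `X₀^r(k,n,s;z)`: sum of `L^r_{N,a}(k;z)` over all admissible indices of
weight `k`, depth `n` and height `s`. -/
noncomputable def X0z (N a : ℕ) (r : ℝ) (k n s : ℕ) (z : ℝ) : ℝ :=
  ∑' l : {l : List ℕ // IsAdmissible l ∧ l.sum = k ∧ l.length = n ∧ height l = s},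
    iLv N a r l.1 z

/-- `X^r(k,n,s;z)`: sum of `L^r_{N,a}(k;z)` over all indices of
weight `k`, depth `n` and height `s`. -/
noncomputable def Xz (N a : ℕ) (r : ℝ) (k n s : ℕ) (z : ℝ) : ℝ :=
  ∑' l : {l : List ℕ // (∀ i ∈ l, 1 ≤ i) ∧ l.sum = k ∧ l.length = n ∧ height l = s},
    iLv N a r l.1 z

open Finset in
theorem summable_prod_pow_fin (n : ℕ) {w : ℝ} (hw0 : 0 ≤ w) (hw1 : w < 1) :
    Summable fun f : Fin n → ℕ => ∏ i, w ^ f i := by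
  induction n with
  | zero => exact (hasSum_fintype _).summable
  | succ n ih =>
    rw [← (Fin.consEquiv fun _ : Fin (n + 1) => ℕ).summable_iff]
    have h := (summable_geometric_of_lt_one hw0 hw1).mul_of_nonneg ih
      (fun m => pow_nonneg hw0 m) (fun f => prod_nonneg fun i _ => pow_nonneg hw0 _)
    refine h.congr fun x => ?_
    simp [Fin.consEquiv, Fin.prod_univ_succ]

/-- The summand of `Lv` for a nonempty index. -/
noncomputable def lvTerm (c : ℕ) (q : List ℕ) (f : Fin (q.length + 1) → ℕ) (t : ℝ) : ℝ :=
  t ^ f 0 * (((f 0 : ℝ) ^ c)⁻¹ * ∏ i : Fin q.length, ((f i.succ : ℝ) ^ q.get i)⁻¹)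

theorem Lv_cons (N a c : ℕ) (q : List ℕ) (t : ℝ) :
    Lv N a (c :: q) t = ∑' m : {f : Fin (q.length + 1) → ℕ //
      StrictAnti f ∧ ∀ i, 0 < f i ∧ f i % N = a % N}, lvTerm c q m.1 t := by
  unfold Lv
  refine tsum_congr fun m => ?_
  have hpos : 0 < (c :: q).length := Nat.succ_pos _
  rw [dif_pos hpos]
  congr 1
  exact Fin.prod_univ_succ (n := q.length)
    (fun i : Fin (q.length + 1) => ((m.1 i : ℝ) ^ (c :: q).get i)⁻¹)

theorem abs_lvTerm_le {c : ℕ} {q : List ℕ} {f : Fin (q.length + 1) → ℕ} (hf : StrictAnti f)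
    (hpos : ∀ i, 0 < f i) {w t : ℝ} (ht0 : 0 ≤ t) (hw0 : 0 ≤ w) (hw1 : w ≤ 1)
    (htw : t ≤ w ^ (q.length + 1)) :
    |lvTerm c q f t| ≤ ∏ i, w ^ f i := by
  have hinv : ∀ i e, ((f i : ℝ) ^ e)⁻¹ ≤ 1 := fun i e =>
    inv_le_one_of_one_le₀ (one_le_pow₀ (by exact_mod_cast hpos i))
  have hprod : ∏ i : Fin q.length, ((f i.succ : ℝ) ^ q.get i)⁻¹ ≤ 1 :=
    Finset.prod_le_one (fun i _ => by positivity) (fun i _ => hinv _ _)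
  have hprod0 : 0 ≤ ∏ i : Fin q.length, ((f i.succ : ℝ) ^ q.get i)⁻¹ :=
    Finset.prod_nonneg fun i _ => by positivity
  unfold lvTerm
  rw [abs_of_nonneg (by positivity)]
  calc _ ≤ t ^ f 0 * 1 := by
        gcongr
        exact mul_le_one₀ (hinv _ _) hprod0 hprod
    _ ≤ (w ^ (q.length + 1)) ^ f 0 := by rw [mul_one]; gcongr
    _ = ∏ _i : Fin (q.length + 1), w ^ f 0 := by simp [← pow_mul, mul_comm]
    _ ≤ _ := Finset.prod_le_prod (fun i _ => by positivity) fun i _ =>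
        pow_le_pow_of_le_one hw0 hw1 (hf.antitone (Fin.zero_le i))

theorem hasDerivAt_lvTerm (c : ℕ) (q : List ℕ) {f : Fin (q.length + 1) → ℕ} (h0 : 0 < f 0)
    {t : ℝ} (ht : 0 < t) :
    HasDerivAt (lvTerm (c + 1) q f) (t⁻¹ * lvTerm c q f t) t := by
  unfold lvTerm
  refine ((hasDerivAt_pow (f 0) t).mul_const _).congr_deriv ?_
  obtain ⟨m, hm⟩ := Nat.exists_eq_succ_of_ne_zero h0.ne'
  have hm' : ((m.succ : ℕ) : ℝ) ≠ 0 := by positivity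
  rw [hm, Nat.succ_sub_one]
  rw [pow_succ t m, pow_succ ((m.succ : ℕ) : ℝ) c]
  field_simp

theorem hasDerivAt_Lv (N a c : ℕ) (q : List ℕ) {z : ℝ} (hz0 : 0 < z) (hz1 : z < 1) :
    HasDerivAt (Lv N a ((c + 1) :: q)) (z⁻¹ * Lv N a (c :: q) z) z := by
  set d := q.length + 1 with hd
  obtain ⟨w, ⟨hw0, hw1⟩, hwz⟩ : ∃ w : ℝ, (0 ≤ w ∧ w < 1) ∧ z < w ^ d := by
    obtain ⟨R, hzR, hR1⟩ := exists_between hz1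
    have hR0 : 0 ≤ R := (hz0.trans hzR).le
    refine ⟨R ^ ((d : ℝ)⁻¹), ⟨Real.rpow_nonneg hR0 _,
      Real.rpow_lt_one hR0 hR1 (by positivity)⟩, ?_⟩
    rwa [Real.rpow_inv_natCast_pow hR0 (by omega)]
  have hsum : Summable fun m : {f : Fin d → ℕ //
      StrictAnti f ∧ ∀ i, 0 < f i ∧ f i % N = a % N} => ∏ i, w ^ m.1 i :=
    (summable_prod_pow_fin d hw0 hw1).comp_injective Subtype.val_injective
  have hmem : z ∈ Set.Ioo (z / 2) (w ^ d) := ⟨by linarith, hwz⟩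
  have hkey := hasDerivAt_tsum_of_isPreconnected (hsum.mul_left (2 / z)) isOpen_Ioo
    (isPreconnected_Ioo (a := z / 2) (b := w ^ d))
    (g := fun m t => lvTerm (c + 1) q m.1 t) (g' := fun m t => t⁻¹ * lvTerm c q m.1 t)
    (fun m t ht => hasDerivAt_lvTerm c q (m.2.2 0).1 (by linarith [ht.1]))
    (fun m t ht => by
      have ht0 : 0 < t := by linarith [ht.1]
      rw [Real.norm_eq_abs, abs_mul, abs_of_pos (inv_pos.2 ht0)]
      refine mul_le_mul ?_ (abs_lvTerm_le m.2.1 (fun i => (m.2.2 i).1) ht0.le hw0 hw1.le ht.2.le)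
        (abs_nonneg _) (by positivity)
      rw [inv_le_comm₀ ht0 (by positivity), inv_div]
      exact ht.1.le)
    hmem
    (Summable.of_norm_bounded hsum fun m =>
      abs_lvTerm_le m.2.1 (fun i => (m.2.2 i).1) hz0.le hw0 hw1.le hwz.le)
    hmem
  rw [tsum_mul_left] at hkey
  rw [Lv_cons]
  exact hkey.congr_of_eventuallyEq (Filter.Eventually.of_forall fun t => Lv_cons N a (c + 1) q t)

theorem groupings_succ_cons (x : ℕ) (l : List ℕ) :
    groupings ((x + 1) :: l) = (groupings (x :: l)).map (List.modifyHead (· + 1)) := by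
  induction l generalizing x with
  | nil => simp [groupings]
  | cons y l ih =>
    rw [groupings, groupings, List.map_append, List.map_map, ← ih (x + y),
      show x + 1 + y = x + y + 1 by omega]
    rfl

theorem exists_cons_of_mem_groupings {x : ℕ} {l p : List ℕ} (hp : p ∈ groupings (x :: l)) :
    ∃ c q, p = c :: q := by
  induction l generalizing x with
  | nil => exact ⟨x, [], by simpa [groupings] using hp⟩
  | cons y l ih =>
    rw [groupings, List.mem_append, List.mem_map] at hp
    rcases hp with ⟨q, -, rfl⟩ | hp
    · exact ⟨x, q, rfl⟩
    · exact ih hp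

theorem hasDerivAt_list_sum {ι : Type*} (L : List ι) (f : ι → ℝ → ℝ) (f' : ι → ℝ) (z : ℝ)
    (h : ∀ i ∈ L, HasDerivAt (f i) (f' i) z) :
    HasDerivAt (fun t => (L.map fun i => f i t).sum) (L.map f').sum z := by
  induction L with
  | nil => simpa using hasDerivAt_const z (0 : ℝ)
  | cons i L ih =>
    simp only [List.map_cons, List.sum_cons]
    exact (h i (by simp)).add (ih fun j hj => h j (by simp [hj]))

theorem hasDerivAt_iLv (N a : ℕ) (r : ℝ) (x : ℕ) (l : List ℕ) {z : ℝ} (hz0 : 0 < z)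
    (hz1 : z < 1) :
    HasDerivAt (iLv N a r ((x + 1) :: l)) (z⁻¹ * iLv N a r (x :: l) z) z := by
  have h := hasDerivAt_list_sum (groupings (x :: l))
    (fun p t => r ^ ((x :: l).length - p.length) * Lv N a (p.modifyHead (· + 1)) t)
    (fun p => z⁻¹ * (r ^ ((x :: l).length - p.length) * Lv N a p z)) z (fun p hp => by
      obtain ⟨c, q, rfl⟩ := exists_cons_of_mem_groupings hp
      exact ((hasDerivAt_Lv N a c q hz0 hz1).const_mul _).congr_deriv (by ring))
  rw [List.sum_map_mul_left] at h
  refine h.congr_of_eventuallyEq (Filter.Eventually.of_forall fun t => ?_)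
  simp [iLv, groupings_succ_cons, Function.comp_def]

theorem finite_positive_lists (k n s : ℕ) :
    {l : List ℕ | (∀ i ∈ l, 1 ≤ i) ∧ l.sum = k ∧ l.length = n ∧ height l = s}.Finite := by
  refine (Set.finite_range (Composition.blocks (n := k))).subset ?_
  rintro l ⟨hl, hk, -⟩
  exact ⟨⟨l, fun hi => hl _ hi, hk⟩, rfl⟩

/-- The finite set of indices of weight `k`, depth `n` and height `s`. -/
noncomputable def indices (k n s : ℕ) : Finset (List ℕ) := (finite_positive_lists k n s).toFinset

theorem mem_indices {k n s : ℕ} {l : List ℕ} :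
    l ∈ indices k n s ↔ (∀ i ∈ l, 1 ≤ i) ∧ l.sum = k ∧ l.length = n ∧ height l = s := by
  simp [indices]

theorem Xz_eq_sum (N a : ℕ) (r : ℝ) (k n s : ℕ) (z : ℝ) :
    Xz N a r k n s z = ∑ l ∈ indices k n s, iLv N a r l z := by
  rw [← Finset.tsum_subtype]
  exact ((Equiv.subtypeEquivRight fun l => mem_indices).tsum_eq
    fun l : {l : List ℕ // _} => iLv N a r l.1 z).symm

theorem X0z_eq_sum (N a : ℕ) (r : ℝ) (k n s : ℕ) (z : ℝ) :
    X0z N a r k n s z = ∑ l ∈ indices k n s with 2 ≤ l.headI, iLv N a r l z := by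
  rw [← Finset.tsum_subtype]
  refine ((Equiv.subtypeEquivRight fun l => ?_).tsum_eq
    fun l : {l : List ℕ // _} => iLv N a r l.1 z).symm
  rw [Finset.mem_filter, mem_indices, IsAdmissible]
  tauto

/-- Lowering the first entry by one turns an admissible index into an admissible one of the same
height, or into an index starting with `1` whose height is one less. -/
theorem sum_indices_pred_head (F : List ℕ → ℝ) (k n s : ℕ) (hn : 1 ≤ n) (hs : 1 ≤ s)
    (hk : 1 ≤ k) :
    ∑ l ∈ indices k n s with 2 ≤ l.headI, F (l.modifyHead (· - 1)) =
      ∑ l ∈ indices (k - 1) n s with 2 ≤ l.headI, F l +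
        ∑ l ∈ indices (k - 1) n (s - 1) with ¬ 2 ≤ l.headI, F l := by
  classical
  rw [← Finset.sum_union]
  · refine Finset.sum_nbij' (List.modifyHead (· - 1)) (List.modifyHead (· + 1)) ?_ ?_ ?_ ?_ ?_
    · rintro (_ | ⟨x, l⟩) hl
      · simp at hl
      · simp only [Finset.mem_union, Finset.mem_filter, mem_indices, List.modifyHead_cons,
          List.forall_mem_cons, List.sum_cons, List.length_cons, height, List.countP_cons,
          List.headI_cons, decide_eq_true_eq] at hl ⊢
        grind
    · rintro (_ | ⟨x, l⟩) hl
      · simp [mem_indices] at hl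
        omega
      · simp only [Finset.mem_union, Finset.mem_filter, mem_indices, List.modifyHead_cons,
          List.forall_mem_cons, List.sum_cons, List.length_cons, height, List.countP_cons,
          List.headI_cons, decide_eq_true_eq] at hl ⊢
        grind
    · rintro (_ | ⟨x, l⟩) hl
      · rfl
      · simp only [Finset.mem_filter, List.headI_cons] at hl
        simp only [List.modifyHead_cons, List.cons.injEq, and_true]
        omega
    · rintro (_ | ⟨x, l⟩) -
      · rfl
      · simp
    · intros
      rfl
  · rw [Finset.disjoint_left]
    intro l h h'
    exact (Finset.mem_filter.1 h').2 (Finset.mem_filter.1 h).2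

/-- For `k ≥ n + s` and `n ≥ s ≥ 1`, on `0 < z < 1` one has
`(d/dz)X₀^r(k,n,s;z) = (1/z)[X^r(k-1,n,s-1;z) + X₀^r(k-1,n,s;z) - X₀^r(k-1,n,s-1;z)]`. -/
theorem stmt14 (N : ℕ) (hN : 1 ≤ N) (a : ℕ) (ha1 : 1 ≤ a) (ha2 : a ≤ N) (r : ℝ)
    (k n s : ℕ) (h1 : n + s ≤ k) (h2 : s ≤ n) (h3 : 1 ≤ s)
    (z : ℝ) (hz0 : 0 < z) (hz1 : z < 1) :
    HasDerivAt (fun t => X0z N a r k n s t)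
      (1 / z * (Xz N a r (k - 1) n (s - 1) z + X0z N a r (k - 1) n s z
        - X0z N a r (k - 1) n (s - 1) z)) z := by
  have hderiv : HasDerivAt (fun t => ∑ l ∈ indices k n s with 2 ≤ l.headI, iLv N a r l t)
      (∑ l ∈ indices k n s with 2 ≤ l.headI, z⁻¹ * iLv N a r (l.modifyHead (· - 1)) z) z := by
    refine HasDerivAt.fun_sum fun l hl => ?_
    obtain _ | ⟨x, l⟩ := l
    · simp at hl
    · obtain ⟨y, rfl⟩ : ∃ y, x = y + 1 := ⟨x - 1, by
        simp only [Finset.mem_filter, List.headI_cons] at hl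
        omega⟩
      exact hasDerivAt_iLv N a r y l hz0 hz1
  simp only [X0z_eq_sum, Xz_eq_sum]
  refine hderiv.congr_deriv ?_
  rw [← Finset.mul_sum, sum_indices_pred_head (fun l => iLv N a r l z) k n s (by omega) h3
    (by omega), one_div, ← Finset.sum_filter_add_sum_filter_not (indices (k - 1) n (s - 1))
    (fun l => 2 ≤ l.headI)]
  ring
end

section
/- Let N be a positive integer, let a be an integer with 1 ≤ a ≤ N, let r be a real number, and let (k_1,…,k_n) be an index of positive integers of weight k = k_1+⋯+k_n. Then for real z with 0 < z < 1, L^r_{N,a}(k_1,…,k_n;z) equals the iterated integral ∫_{z > z_1 > ⋯ > z_k > 0} ∏_{i=1}^k f_i(z_i) dz_1⋯dz_k over the open simplex {(z_1,…,z_k) : z > z_1 > ⋯ > z_k > 0}, where f_i(t) = r/t + t^{N−1}/(1−t^N) if i ∈ {k_1, k_1+k_2, …, k_1+⋯+k_{n−1}}, f_k(t) = t^{a−1}/(1−t^N), and f_i(t) = 1/t otherwise. -/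
open MeasureTheory

/-- The proper partial sums `k₁, k₁+k₂, …, k₁+⋯+k_{n-1}` of an index. -/
def prefixSums (k : List ℕ) : List ℕ :=
  (List.range (k.length - 1)).map (fun j => (k.take (j + 1)).sum)

/-- The open simplex `z > y₀ > ⋯ > y_{n-1} > 0`. -/
def openSimplex (n : ℕ) (z : ℝ) : Set (Fin n → ℝ) :=
  {y | StrictAnti y ∧ ∀ i, 0 < y i ∧ y i < z}

/-- The product `∏ gᵢ(yᵢ)` cut off to the open simplex. -/
noncomputable def simplexIntegrand (n : ℕ) (g : ℕ → ℝ → ℝ) (z : ℝ) (y : Fin n → ℝ) : ℝ :=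
  (openSimplex n z).indicator (fun y => ∏ i : Fin n, g i (y i)) y

lemma strictAnti_cons_iff {α : Type*} [Preorder α] {n : ℕ} (t : α) (y : Fin n → α) :
    StrictAnti (Fin.cons t y : Fin (n + 1) → α) ↔ StrictAnti y ∧ ∀ i, y i < t := by
  constructor
  · intro h
    refine ⟨fun i j hij => ?_, fun i => ?_⟩
    · simpa using h (Fin.succ_lt_succ_iff.2 hij)
    · simpa using h (Fin.succ_pos i)
  · rintro ⟨h, h'⟩ i j hij
    induction j using Fin.cases with
    | zero => exact absurd hij (Fin.not_lt_zero i)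
    | succ j =>
      induction i using Fin.cases with
      | zero => simpa using h' j
      | succ i => simpa using h (Fin.succ_lt_succ_iff.1 hij)

lemma cons_mem_openSimplex_iff {n : ℕ} {z t : ℝ} {y : Fin n → ℝ} :
    (Fin.cons t y : Fin (n + 1) → ℝ) ∈ openSimplex (n + 1) z ↔
      t ∈ Set.Ioo 0 z ∧ y ∈ openSimplex n t := by
  simp only [openSimplex, Set.mem_ofPred_eq, strictAnti_cons_iff, Fin.forall_fin_succ,
    Fin.cons_zero, Fin.cons_succ, Set.mem_Ioo]
  constructor
  · rintro ⟨⟨h1, h2⟩, h3, h4⟩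
    exact ⟨h3, h1, fun i => ⟨(h4 i).1, h2 i⟩⟩
  · rintro ⟨h3, h1, h2⟩
    exact ⟨⟨h1, fun i => (h2 i).2⟩, h3, fun i => ⟨(h2 i).1, (h2 i).2.trans h3.2⟩⟩

lemma measurableSet_openSimplex (n : ℕ) (z : ℝ) : MeasurableSet (openSimplex n z) := by
  have h : openSimplex n z = {y | ∀ i j, i < j → y j < y i} ∩ {y | ∀ i, 0 < y i ∧ y i < z} := by
    ext y
    simp [openSimplex, StrictAnti]
  rw [h]
  simp only [Set.ofPred_forall, Set.ofPred_and]
  refine MeasurableSet.inter ?_ ?_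
  · exact MeasurableSet.iInter fun i => MeasurableSet.iInter fun j => MeasurableSet.iInter fun _ =>
      measurableSet_lt (measurable_pi_apply j) (measurable_pi_apply i)
  · exact MeasurableSet.iInter fun i =>
      (measurableSet_lt measurable_const (measurable_pi_apply i)).inter
        (measurableSet_lt (measurable_pi_apply i) measurable_const)

lemma measurable_simplexIntegrand (n : ℕ) {g : ℕ → ℝ → ℝ} (hg : ∀ i, Measurable (g i)) (z : ℝ) :
    Measurable (simplexIntegrand n g z) := by
  have h : Measurable fun y : Fin n → ℝ => ∏ i : Fin n, g i (y i) :=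
    Finset.measurable_fun_prod _ fun i _ => (hg i).comp (measurable_pi_apply i)
  exact h.indicator (measurableSet_openSimplex n z)

lemma simplexIntegrand_cons (n : ℕ) (g : ℕ → ℝ → ℝ) (z t : ℝ) (y : Fin n → ℝ) :
    simplexIntegrand (n + 1) g z (Fin.cons t y) =
      (Set.Ioo 0 z).indicator (g 0) t * simplexIntegrand n (fun i => g (i + 1)) t y := by
  unfold simplexIntegrand
  by_cases ht : t ∈ Set.Ioo 0 z
  · by_cases hy : y ∈ openSimplex n t
    · rw [Set.indicator_of_mem (cons_mem_openSimplex_iff.2 ⟨ht, hy⟩), Set.indicator_of_mem ht,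
        Set.indicator_of_mem hy, Fin.prod_univ_succ]
      simp
    · rw [Set.indicator_of_notMem (fun h => hy (cons_mem_openSimplex_iff.1 h).2),
        Set.indicator_of_notMem hy, mul_zero]
  · rw [Set.indicator_of_notMem (fun h => ht (cons_mem_openSimplex_iff.1 h).1),
      Set.indicator_of_notMem ht, zero_mul]

lemma integral_simplexIntegrand_zero (g : ℕ → ℝ → ℝ) (z : ℝ) :
    Integrable (simplexIntegrand 0 g z) ∧ ∫ y, ‖simplexIntegrand 0 g z y‖ = 1 ∧
      ∫ y, simplexIntegrand 0 g z y = 1 := by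
  have h : simplexIntegrand 0 g z = fun _ => 1 := by
    ext y
    have : y ∈ openSimplex 0 z := ⟨fun i => i.elim0, fun i => i.elim0⟩
    simp [simplexIntegrand, this]
  rw [h]
  have hv : (volume : Measure (Fin 0 → ℝ)) Set.univ = 1 := by simp [volume_pi]
  have : IsProbabilityMeasure (volume : Measure (Fin 0 → ℝ)) := ⟨hv⟩
  exact ⟨integrable_const _, by simp, by simp⟩

lemma integral_simplexIntegrand_succ (n : ℕ) {g : ℕ → ℝ → ℝ} (hg : ∀ i, Measurable (g i))
    {K z : ℝ} (hz : 0 < z)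
    (hint : ∀ t ∈ Set.Ioo 0 z, Integrable (simplexIntegrand n (fun i => g (i + 1)) t))
    (hK : ∀ t ∈ Set.Ioo 0 z, |g 0 t| * ∫ y, ‖simplexIntegrand n (fun i => g (i + 1)) t y‖ ≤ K) :
    Integrable (simplexIntegrand (n + 1) g z) ∧
      ∫ y, ‖simplexIntegrand (n + 1) g z y‖ ≤ K * z ∧
      ∫ y, simplexIntegrand (n + 1) g z y =
        ∫ t in Set.Ioo 0 z, g 0 t * ∫ y, simplexIntegrand n (fun i => g (i + 1)) t y := by
  set e := MeasurableEquiv.piFinSuccAbove (fun _ : Fin (n + 1) => ℝ) 0 with he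
  have hmp : MeasurePreserving e := volume_preserving_piFinSuccAbove (fun _ => ℝ) 0
  have hmp' : MeasurePreserving e.symm := hmp.symm e
  set f : ℝ × (Fin n → ℝ) → ℝ := fun p =>
    (Set.Ioo 0 z).indicator (g 0) p.1 * simplexIntegrand n (fun i => g (i + 1)) p.1 p.2 with hf
  have hfe : ∀ p, simplexIntegrand (n + 1) g z (e.symm p) = f p := by
    intro p
    refine Eq.trans ?_ (simplexIntegrand_cons n g z p.1 p.2)
    congr 1
    exact Fin.insertNth_zero' p.1 p.2
  have hfm : Measurable f := by
    have : f = fun p => simplexIntegrand (n + 1) g z (e.symm p) := funext fun p => (hfe p).symm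
    rw [this]
    exact (measurable_simplexIntegrand (n + 1) hg z).comp e.symm.measurable
  have hnorm : ∀ t, ∫ y, ‖f (t, y)‖ =
      (Set.Ioo 0 z).indicator (fun t => |g 0 t| *
        ∫ y, ‖simplexIntegrand n (fun i => g (i + 1)) t y‖) t := by
    intro t
    simp only [hf, norm_mul, integral_const_mul]
    by_cases ht : t ∈ Set.Ioo 0 z <;> simp [ht]
  have hnorm' : ∀ t, ∫ y, ‖f (t, y)‖ ≤ (Set.Ioo 0 z).indicator (fun _ => K) t := by
    intro t
    rw [hnorm]
    by_cases ht : t ∈ Set.Ioo 0 z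
    · simpa [ht] using hK t ht
    · simp [ht]
  have hconst : Integrable ((Set.Ioo 0 z).indicator (fun _ => K)) := by
    rw [integrable_indicator_iff measurableSet_Ioo]
    exact integrableOn_const (by simp)
  have hfn : Integrable (fun t => ∫ y, ‖f (t, y)‖) := by
    refine hconst.mono' hfm.norm.aestronglyMeasurable.integral_prod_right' (ae_of_all _ fun t => ?_)
    rw [Real.norm_of_nonneg (integral_nonneg fun y => norm_nonneg _)]
    exact hnorm' t
  have hfi : Integrable f (volume.prod volume) := by
    rw [integrable_prod_iff hfm.aestronglyMeasurable]
    refine ⟨ae_of_all _ fun t => ?_, hfn⟩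
    by_cases ht : t ∈ Set.Ioo 0 z
    · exact (hint t ht).const_mul ((Set.Ioo 0 z).indicator (g 0) t)
    · simp [hf, ht]
  have hcomp : simplexIntegrand (n + 1) g z ∘ e.symm = f := funext hfe
  refine ⟨?_, ?_, ?_⟩
  · rw [← hmp'.integrable_comp_emb e.symm.measurableEmbedding, hcomp]
    exact hfi
  · rw [← hmp'.integral_comp e.symm.measurableEmbedding]
    simp only [hfe]
    rw [Measure.volume_eq_prod, integral_prod _ hfi.norm]
    refine (integral_mono hfn hconst hnorm').trans (le_of_eq ?_)
    rw [integral_indicator measurableSet_Ioo]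
    simp [hz.le, mul_comm]
  · rw [← hmp'.integral_comp e.symm.measurableEmbedding]
    simp only [hfe]
    rw [Measure.volume_eq_prod, integral_prod _ hfi, ← integral_indicator measurableSet_Ioo]
    refine integral_congr_ae (ae_of_all _ fun t => ?_)
    simp only [hf, integral_const_mul]
    by_cases ht : t ∈ Set.Ioo 0 z <;> simp [ht]

lemma hasSum_of_forall_eq {ι : Type*} {f g : ι → ℝ} {s : ℝ} (h : ∀ i, f i = g i)
    (hg : HasSum g s) : HasSum f s := by
  rwa [funext h]

/-- A sequence of at most polynomial growth. -/
def PolyBounded (c : ℕ → ℝ) : Prop :=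
  ∃ (K : ℝ) (p : ℕ), ∀ m, |c m| ≤ K * (m + 1 : ℝ) ^ p

namespace PolyBounded

lemma const (b : ℝ) : PolyBounded fun _ => b := ⟨|b|, 0, by simp⟩

lemma mono {b c : ℕ → ℝ} (hc : PolyBounded c) (h : ∀ m, |b m| ≤ |c m|) : PolyBounded b := by
  obtain ⟨K, p, hK⟩ := hc
  exact ⟨K, p, fun m => (h m).trans (hK m)⟩

lemma add {b c : ℕ → ℝ} (hb : PolyBounded b) (hc : PolyBounded c) :
    PolyBounded fun m => b m + c m := by
  obtain ⟨K, p, hK⟩ := hb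
  obtain ⟨L, q, hL⟩ := hc
  have hK0 : 0 ≤ K := by simpa using (abs_nonneg _).trans (hK 0)
  have hL0 : 0 ≤ L := by simpa using (abs_nonneg _).trans (hL 0)
  refine ⟨K + L, p + q, fun m => (abs_add_le _ _).trans ?_⟩
  have h1 : (1 : ℝ) ≤ m + 1 := by simp
  have hp : (m + 1 : ℝ) ^ p ≤ (m + 1) ^ (p + q) := pow_le_pow_right₀ h1 (by simp)
  have hq : (m + 1 : ℝ) ^ q ≤ (m + 1) ^ (p + q) := pow_le_pow_right₀ h1 (by simp)
  calc |b m| + |c m| ≤ K * (m + 1 : ℝ) ^ p + L * (m + 1 : ℝ) ^ q := add_le_add (hK m) (hL m)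
    _ ≤ K * (m + 1 : ℝ) ^ (p + q) + L * (m + 1 : ℝ) ^ (p + q) := by gcongr
    _ = _ := by ring

lemma const_mul {c : ℕ → ℝ} (hc : PolyBounded c) (b : ℝ) : PolyBounded fun m => b * c m := by
  obtain ⟨K, p, hK⟩ := hc
  refine ⟨|b| * K, p, fun m => ?_⟩
  rw [abs_mul, mul_assoc]
  exact mul_le_mul_of_nonneg_left (hK m) (abs_nonneg b)

lemma sum_range {c : ℕ → ℝ} (hc : PolyBounded c) :
    PolyBounded fun m => ∑ j ∈ Finset.range m, c j := by
  obtain ⟨K, p, hK⟩ := hc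
  have hK0 : 0 ≤ K := by simpa using (abs_nonneg _).trans (hK 0)
  refine ⟨K, p + 1, fun m => (Finset.abs_sum_le_sum_abs _ _).trans ?_⟩
  have h : ∀ j ∈ Finset.range m, |c j| ≤ K * (m + 1 : ℝ) ^ p := fun j hj => by
    refine (hK j).trans ?_
    have : (j : ℝ) ≤ m := by exact_mod_cast (Finset.mem_range.1 hj).le
    gcongr
  refine (Finset.sum_le_card_nsmul _ _ _ h).trans ?_
  rw [Finset.card_range, nsmul_eq_mul, pow_succ]
  have : 0 ≤ K * (m + 1 : ℝ) ^ p := by positivity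
  nlinarith

lemma summable_norm {c : ℕ → ℝ} (hc : PolyBounded c) {t : ℝ} (h0 : 0 ≤ t) (h1 : t < 1) :
    Summable fun m => ‖c m * t ^ m‖ := by
  obtain ⟨K, p, hK⟩ := hc
  have hs : Summable fun m : ℕ => (m : ℝ) ^ p * t ^ m :=
    summable_pow_mul_geometric_of_norm_lt_one p (by rwa [Real.norm_of_nonneg h0])
  have hg : Summable fun m : ℕ => t ^ m := summable_geometric_of_lt_one h0 h1
  refine Summable.of_nonneg_of_le (fun m => norm_nonneg _) (fun m => ?_)
    (((hs.add hg).mul_left (K * 2 ^ p)))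
  have hK0 : 0 ≤ K := by simpa using (abs_nonneg _).trans (hK 0)
  have hb : (m + 1 : ℝ) ^ p ≤ 2 ^ p * ((m : ℝ) ^ p + 1) := by
    rcases Nat.eq_zero_or_pos m with rfl | hm
    · have : (1 : ℝ) ≤ 2 ^ p := one_le_pow₀ (by norm_num)
      have h0p : (0 : ℝ) ≤ 0 ^ p := by positivity
      simp only [Nat.cast_zero, zero_add, one_pow]
      nlinarith
    · have : (m + 1 : ℝ) ≤ 2 * m := by
        have : (1 : ℝ) ≤ m := by exact_mod_cast hm
        linarith
      calc (m + 1 : ℝ) ^ p ≤ (2 * m) ^ p := by gcongr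
        _ = 2 ^ p * (m : ℝ) ^ p := mul_pow _ _ _
        _ ≤ _ := by gcongr; simp
  rw [norm_mul, Real.norm_eq_abs, norm_pow, Real.norm_of_nonneg h0]
  calc |c m| * t ^ m ≤ (K * (2 ^ p * ((m : ℝ) ^ p + 1))) * t ^ m := by
        gcongr
        exact (hK m).trans (by gcongr)
    _ = _ := by ring

lemma summable {c : ℕ → ℝ} (hc : PolyBounded c) {t : ℝ} (h0 : 0 ≤ t) (h1 : t < 1) :
    Summable fun m => c m * t ^ m := (hc.summable_norm h0 h1).of_norm

end PolyBounded

lemma integral_Ioo_pow (m : ℕ) {z : ℝ} (hz : 0 ≤ z) :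
    ∫ t in Set.Ioo 0 z, t ^ m = z ^ (m + 1) / (m + 1) := by
  rw [← integral_Ioc_eq_integral_Ioo, ← intervalIntegral.integral_of_le hz, integral_pow]
  simp

lemma integral_one_div_mul_tsum {b : ℕ → ℝ} (hb : PolyBounded b) (hb0 : b 0 = 0) {z : ℝ}
    (hz0 : 0 < z) (hz1 : z < 1) :
    ∫ t in Set.Ioo 0 z, 1 / t * ∑' m, b m * t ^ m = ∑' m, b m / m * z ^ m := by
  have hF : ∀ m, ∀ t ∈ Set.Ioo 0 z, 1 / t * (b m * t ^ m) = b m * t ^ (m - 1) := by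
    intro m t ht
    rcases m with _ | m
    · simp [hb0]
    · have := ht.1.ne'
      rw [Nat.add_sub_cancel, pow_succ]
      field_simp
  have hint : ∀ m, IntegrableOn (fun t : ℝ => t ^ m) (Set.Ioo 0 z) := fun m =>
    ((continuous_pow m).integrableOn_Icc).mono_set Set.Ioo_subset_Icc_self
  have hval : ∀ m, b m * ∫ t in Set.Ioo 0 z, t ^ (m - 1) = b m / m * z ^ m := by
    intro m
    rcases m with _ | m
    · simp [hb0]
    · rw [integral_Ioo_pow _ hz0.le]
      simp only [Nat.add_sub_cancel, Nat.cast_add, Nat.cast_one]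
      ring
  have hnorm : ∀ m, ∫ t in Set.Ioo 0 z, ‖b m * t ^ (m - 1)‖ = ‖b m / m * z ^ m‖ := by
    intro m
    have : ∫ t in Set.Ioo 0 z, ‖b m * t ^ (m - 1)‖ =
        ∫ t in Set.Ioo 0 z, |b m| * t ^ (m - 1) := by
      refine setIntegral_congr_fun measurableSet_Ioo fun t ht => ?_
      simp [abs_of_pos ht.1]
    rw [this, integral_const_mul]
    rcases m with _ | m
    · simp [hb0]
    · rw [integral_Ioo_pow _ hz0.le]
      simp only [Nat.add_sub_cancel, Nat.cast_add, Nat.cast_one, norm_mul, norm_div, norm_pow,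
        Real.norm_eq_abs, abs_of_pos hz0]
      rw [abs_of_pos (by positivity : (0 : ℝ) < m + 1)]
      ring
  have hbm : PolyBounded fun m => b m / m := by
    refine hb.mono fun m => ?_
    rcases m with _ | m
    · simp
    · rw [abs_div]
      refine div_le_self (abs_nonneg _) ?_
      rw [Nat.abs_cast]
      simp
  have h := hasSum_integral_of_summable_integral_norm
    (F := fun m t => b m * t ^ (m - 1)) (μ := volume.restrict (Set.Ioo 0 z))
    (fun m => (hint (m - 1)).const_mul _) (by
      simp only [hnorm]
      exact hbm.summable_norm hz0.le hz1)
  simp only [integral_const_mul, hval] at h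
  rw [h.tsum_eq]
  refine setIntegral_congr_fun measurableSet_Ioo fun t ht => ?_
  rw [← tsum_mul_left]
  exact tsum_congr fun m => hF m t ht

lemma tsum_sum_range_modEq {N a : ℕ} (hN : 1 ≤ N) {c : ℕ → ℝ} (hc : PolyBounded c)
    (hsupp : ∀ m, ¬ (0 < m ∧ m % N = a % N) → c m = 0) {t : ℝ} (h0 : 0 ≤ t) (h1 : t < 1) :
    ∑' m, (if 0 < m ∧ m % N = a % N then ∑ j ∈ Finset.range m, c j else 0) * t ^ m =
      t ^ N / (1 - t ^ N) * ∑' m, c m * t ^ m := by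
  set d : ℕ → ℝ := fun m => if 0 < m ∧ m % N = a % N then ∑ j ∈ Finset.range m, c j else 0 with hd
  have hdb : PolyBounded d := hc.sum_range.mono fun m => by
    simp only [hd]; split_ifs <;> simp
  have hz : ∀ m < N, d m = 0 := by
    intro m hm
    simp only [hd]
    split_ifs with h
    · refine Finset.sum_eq_zero fun j hj => hsupp j fun hj' => ?_
      have hjm := Finset.mem_range.1 hj
      have := hj'.2.trans h.2.symm
      rw [Nat.mod_eq_of_lt hm, Nat.mod_eq_of_lt (hjm.trans hm)] at this
      omega
    · rfl
  have hstep : ∀ m, d (m + N) = c m + d m := by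
    intro m
    simp only [hd, Nat.add_mod_right]
    by_cases hm : m % N = a % N
    · have : 0 < m + N := by omega
      have hsum : ∑ j ∈ Finset.range (m + N), c j = c m + ∑ j ∈ Finset.range m, c j := by
        rw [Finset.sum_range_add, add_comm]
        congr 1
        rw [Finset.sum_eq_single 0]
        · simp
        · intro j hj hj0
          refine hsupp _ fun h => hj0 ?_
          have h2 : (m + j) % N = (m + 0) % N := by simpa using h.2.trans hm.symm
          have h3 : j ≡ 0 [MOD N] := Nat.ModEq.add_left_cancel' m h2
          have h4 := Finset.mem_range.1 hj
          rw [Nat.ModEq, Nat.mod_eq_of_lt h4] at h3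
          simpa using h3
        · intro h
          simp at h
          omega
      rw [if_pos ⟨this, hm⟩, hsum]
      rcases Nat.eq_zero_or_pos m with rfl | hm0
      · simp
      · rw [if_pos ⟨hm0, hm⟩]
    · simp [hm, hsupp m (fun h => hm h.2)]
  have hds := hdb.summable h0 h1
  have hcs := hc.summable h0 h1
  have key : ∑' m, d m * t ^ m = t ^ N * (∑' m, c m * t ^ m + ∑' m, d m * t ^ m) := by
    conv_lhs => rw [← hds.sum_add_tsum_nat_add N]
    rw [Finset.sum_eq_zero fun m hm => by rw [hz m (Finset.mem_range.1 hm), zero_mul], zero_add,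
      ← hcs.tsum_add hds, ← tsum_mul_left]
    refine tsum_congr fun m => ?_
    rw [hstep, pow_add]
    ring
  have htN : t ^ N < 1 := pow_lt_one₀ h0 h1 (by omega)
  have : 1 - t ^ N ≠ 0 := by linarith
  field_simp
  linarith

lemma tsum_modEq {N a : ℕ} (ha1 : 1 ≤ a) (ha2 : a ≤ N) {t : ℝ} (h0 : 0 ≤ t) (h1 : t < 1) :
    ∑' m : ℕ, (if 0 < m ∧ m % N = a % N then (1 : ℝ) else 0) * t ^ m = t ^ a / (1 - t ^ N) := by
  have htN : t ^ N < 1 := pow_lt_one₀ h0 h1 (by omega)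
  have hg := (hasSum_geometric_of_lt_one (pow_nonneg h0 N) htN).mul_left (t ^ a)
  have hinj : Function.Injective fun j : ℕ => a + N * j := fun i j h => by
    have : N * i = N * j := Nat.add_left_cancel h
    exact Nat.eq_of_mul_eq_mul_left (by omega) this
  rw [div_eq_mul_inv]
  refine HasSum.tsum_eq ((hinj.hasSum_iff ?_).1 ?_)
  · intro m hm
    rw [if_neg, zero_mul]
    rintro ⟨hm0, hma⟩
    apply hm
    have hle : a ≤ m := by
      by_contra! hlt
      rw [Nat.mod_eq_of_lt (by omega : m < N)] at hma
      rcases ha2.eq_or_lt with h | h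
      · rw [h, Nat.mod_self] at hma
        omega
      · rw [Nat.mod_eq_of_lt h] at hma
        omega
    obtain ⟨j, hj⟩ := (Nat.modEq_iff_dvd' hle).1 hma.symm
    exact ⟨j, by simp only; omega⟩
  · refine hasSum_of_forall_eq (fun j => ?_) hg
    have : 0 < a + N * j := by omega
    rw [Function.comp_apply, if_pos ⟨this, Nat.add_mul_mod_self_left a N j⟩, one_mul, pow_add,
      pow_mul]

/-- The truncated sum `Σ_{M > m₁ > ⋯ > mₙ > 0, mᵢ ≡ a (mod N)} 1/(m₁^{k₁} ⋯ mₙ^{kₙ})`. -/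
noncomputable def truncSum (N a : ℕ) : List ℕ → ℕ → ℝ
  | [], _ => 1
  | x :: l, M => ∑ m ∈ Finset.range M,
      (if 0 < m ∧ m % N = a % N then ((m : ℝ) ^ x)⁻¹ else 0) * truncSum N a l m

/-- The coefficient of `z ^ m` in `L_{N,a}(k; z)`, for nonempty `k`. -/
noncomputable def seriesCoeff (N a : ℕ) : List ℕ → ℕ → ℝ
  | [], _ => 0
  | x :: l, m => (if 0 < m ∧ m % N = a % N then ((m : ℝ) ^ x)⁻¹ else 0) * truncSum N a l m

/-- The coefficient of `z ^ m` in `L^r_{N,a}(k; z)`, for nonempty `k`. -/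
noncomputable def interpCoeff (N a : ℕ) (r : ℝ) : List ℕ → ℕ → ℝ
  | [], _ => 0
  | [x], m => if 0 < m ∧ m % N = a % N then ((m : ℝ) ^ x)⁻¹ else 0
  | x :: y :: l, m => (if 0 < m ∧ m % N = a % N then ((m : ℝ) ^ x)⁻¹ else 0) *
      (r * interpCoeff N a r (y :: l) m + ∑ j ∈ Finset.range m, interpCoeff N a r (y :: l) j)

lemma truncSum_eq_sum_seriesCoeff (N a : ℕ) {l : List ℕ} (hl : l ≠ []) (M : ℕ) :
    truncSum N a l M = ∑ m ∈ Finset.range M, seriesCoeff N a l m := by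
  cases l with
  | nil => exact absurd rfl hl
  | cons x l => rfl

lemma abs_ite_inv_pow_le_one (P : ℕ → Prop) [DecidablePred P] (x m : ℕ) :
    |if 0 < m ∧ P m then ((m : ℝ) ^ x)⁻¹ else 0| ≤ 1 := by
  split_ifs with h
  · have : (1 : ℝ) ≤ (m : ℝ) ^ x := one_le_pow₀ (by exact_mod_cast h.1)
    rw [abs_of_nonneg (by positivity)]
    exact inv_le_one_of_one_le₀ this
  · simp

lemma polyBounded_ite_inv_pow_mul (N a x : ℕ) {c : ℕ → ℝ} (hc : PolyBounded c) :
    PolyBounded fun m => (if 0 < m ∧ m % N = a % N then ((m : ℝ) ^ x)⁻¹ else 0) * c m :=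
  hc.mono fun m => by
    rw [abs_mul]
    exact mul_le_of_le_one_left (abs_nonneg _) (abs_ite_inv_pow_le_one (fun m => m % N = a % N) x m)

lemma polyBounded_truncSum (N a : ℕ) (l : List ℕ) : PolyBounded (truncSum N a l) := by
  induction l with
  | nil => exact PolyBounded.const 1
  | cons x l ih => exact (polyBounded_ite_inv_pow_mul N a x ih).sum_range

lemma polyBounded_seriesCoeff (N a : ℕ) (l : List ℕ) : PolyBounded (seriesCoeff N a l) := by
  cases l with
  | nil => exact PolyBounded.const 0
  | cons x l => exact polyBounded_ite_inv_pow_mul N a x (polyBounded_truncSum N a l)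

lemma polyBounded_interpCoeff (N a : ℕ) (r : ℝ) (l : List ℕ) :
    PolyBounded (interpCoeff N a r l) := by
  induction l with
  | nil => exact PolyBounded.const 0
  | cons x l ih =>
    cases l with
    | nil => simpa [interpCoeff] using polyBounded_ite_inv_pow_mul N a x (PolyBounded.const 1)
    | cons y l => exact polyBounded_ite_inv_pow_mul N a x ((ih.const_mul r).add ih.sum_range)

lemma interpCoeff_support (N a : ℕ) (r : ℝ) (l : List ℕ) {m : ℕ}
    (hm : ¬ (0 < m ∧ m % N = a % N)) : interpCoeff N a r l m = 0 := by
  match l with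
  | [] => rfl
  | [x] => simp only [interpCoeff, if_neg hm]
  | x :: y :: l => simp only [interpCoeff, if_neg hm, zero_mul]

lemma length_le_of_mem_groupings (k : List ℕ) :
    ∀ p ∈ groupings k, p.length ≤ k.length ∧ (k ≠ [] → p ≠ []) := by
  induction k using groupings.induct with
  | case1 => simp [groupings]
  | case2 x => simp [groupings]
  | case3 x y l ih1 ih2 =>
    intro p hp
    rw [groupings, List.mem_append, List.mem_map] at hp
    rcases hp with ⟨q, hq, rfl⟩ | hp
    · have := (ih1 q hq).1
      simpa using this
    · have := ih2 p hp
      simp only [List.length_cons] at this ⊢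
      exact ⟨by omega, fun _ => this.2 (by simp)⟩

lemma list_sum_map_finset_sum {ι α : Type*} (s : Finset ι) (L : List α) (f : α → ι → ℝ) :
    (L.map fun p => ∑ i ∈ s, f p i).sum = ∑ i ∈ s, (L.map fun p => f p i).sum := by
  induction L with
  | nil => simp
  | cons p L ih => simp [ih, Finset.sum_add_distrib]

lemma interpCoeff_add_cons (N a : ℕ) (r : ℝ) (x y : ℕ) (l : List ℕ) (m : ℕ) :
    interpCoeff N a r ((x + y) :: l) m =
      (if 0 < m ∧ m % N = a % N then ((m : ℝ) ^ x)⁻¹ else 0) * interpCoeff N a r (y :: l) m := by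
  cases l <;> simp only [interpCoeff] <;> split_ifs <;> simp [pow_add] <;> ring

lemma sum_groupings_seriesCoeff (N a : ℕ) (r : ℝ) (k : List ℕ) (m : ℕ) :
    k ≠ [] → ((groupings k).map
      (fun p => r ^ (k.length - p.length) * seriesCoeff N a p m)).sum = interpCoeff N a r k m := by
  induction k using groupings.induct generalizing m with
  | case1 => simp
  | case2 x => simp [groupings, seriesCoeff, interpCoeff, truncSum]
  | case3 x y l ih1 ih2 =>
    intro _
    set w : ℝ := if 0 < m ∧ m % N = a % N then ((m : ℝ) ^ x)⁻¹ else 0 with hw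
    have h1 : ((groupings (y :: l)).map (fun p => r ^ ((x :: y :: l).length - (x :: p).length) *
        seriesCoeff N a (x :: p) m)).sum =
        w * ∑ j ∈ Finset.range m, interpCoeff N a r (y :: l) j := by
      simp_rw [← fun j => ih1 j (by simp)]
      rw [← list_sum_map_finset_sum, ← List.sum_map_mul_left]
      refine congrArg List.sum (List.map_congr_left fun p hp => ?_)
      have hp' := (length_le_of_mem_groupings _ p hp).2 (by simp)
      rw [seriesCoeff, truncSum_eq_sum_seriesCoeff N a hp', ← hw, ← Finset.mul_sum]
      simp only [List.length_cons, Nat.add_sub_add_right]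
      ring
    have h2 : ((groupings ((x + y) :: l)).map (fun p => r ^ ((x :: y :: l).length - p.length) *
        seriesCoeff N a p m)).sum = r * (w * interpCoeff N a r (y :: l) m) := by
      rw [hw, ← interpCoeff_add_cons, ← ih2 m (by simp), ← List.sum_map_mul_left]
      refine congrArg List.sum (List.map_congr_left fun p hp => ?_)
      have hp' := (length_le_of_mem_groupings _ p hp).1
      simp only [List.length_cons] at hp' ⊢
      rw [Nat.sub_add_comm hp', pow_succ]
      ring
    rw [groupings, List.map_append, List.sum_append, List.map_map, h2]
    refine (congrArg (· + _) h1).trans ?_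
    rw [interpCoeff, ← hw]
    ring

lemma hasSum_prod_of_nonneg {α β : Type*} {f : α × β → ℝ} (hf : ∀ p, 0 ≤ f p) {g : α → ℝ}
    (hg : ∀ a, HasSum (fun b => f (a, b)) (g a)) {s : ℝ} (hs : HasSum g s) : HasSum f s := by
  have hsum : Summable f := (summable_prod_of_nonneg hf).2
    ⟨fun a => (hg a).summable, by simpa only [(hg _).tsum_eq] using hs.summable⟩
  rw [hs.unique (hsum.hasSum.prod_fiberwise hg)]
  exact hsum.hasSum

/-- The summand of a multiple harmonic sum, extended by zero to all tuples. -/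
noncomputable def harmonicTerm (N a : ℕ) (p : List ℕ) (f : Fin p.length → ℕ) : ℝ :=
  open Classical in
  if StrictAnti f ∧ ∀ i, 0 < f i ∧ f i % N = a % N then
    ∏ i : Fin p.length, ((f i : ℝ) ^ p.get i)⁻¹ else 0

lemma harmonicTerm_nonneg (N a : ℕ) (p : List ℕ) (f : Fin p.length → ℕ) :
    0 ≤ harmonicTerm N a p f := by
  unfold harmonicTerm
  split_ifs
  · positivity
  · exact le_rfl

open Classical in
lemma harmonicTerm_cons (N a x : ℕ) (l : List ℕ) (m : ℕ) (f : Fin l.length → ℕ) :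
    harmonicTerm N a (x :: l) (Fin.cons m f) =
      (if 0 < m ∧ m % N = a % N then ((m : ℝ) ^ x)⁻¹ else 0) *
        (if ∀ i, f i < m then harmonicTerm N a l f else 0) := by
  have key : (StrictAnti (Fin.cons m f : Fin (l.length + 1) → ℕ) ∧
      ∀ i : Fin (x :: l).length, 0 < (Fin.cons m f : Fin (l.length + 1) → ℕ) i ∧
        (Fin.cons m f : Fin (l.length + 1) → ℕ) i % N = a % N) ↔
      (0 < m ∧ m % N = a % N) ∧ (∀ i, f i < m) ∧
        StrictAnti f ∧ ∀ i, 0 < f i ∧ f i % N = a % N := by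
    rw [strictAnti_cons_iff]
    have h : (∀ i : Fin (x :: l).length, 0 < (Fin.cons m f : Fin (l.length + 1) → ℕ) i ∧
        (Fin.cons m f : Fin (l.length + 1) → ℕ) i % N = a % N) ↔
        (0 < m ∧ m % N = a % N) ∧ ∀ i, 0 < f i ∧ f i % N = a % N :=
      Fin.forall_fin_succ (n := l.length)
    rw [h]
    tauto
  have hprod : ∏ i : Fin (x :: l).length,
      (((Fin.cons m f : Fin (l.length + 1) → ℕ) i : ℝ) ^ (x :: l).get i)⁻¹ =
      ((m : ℝ) ^ x)⁻¹ * ∏ i : Fin l.length, ((f i : ℝ) ^ l.get i)⁻¹ :=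
    Fin.prod_univ_succ (n := l.length)
      (fun i => (((Fin.cons m f : Fin (l.length + 1) → ℕ) i : ℝ) ^ (x :: l).get i)⁻¹)
  unfold harmonicTerm
  rw [hprod]
  by_cases h1 : 0 < m ∧ m % N = a % N <;> by_cases h2 : ∀ i, f i < m <;>
    by_cases h3 : StrictAnti f ∧ ∀ i, 0 < f i ∧ f i % N = a % N
  · rw [if_pos (key.2 ⟨h1, h2, h3⟩), if_pos h1, if_pos h2, if_pos h3]
  all_goals
    rw [if_neg (fun h => by have := key.1 h; tauto)]
    simp [h1, h2, h3]

lemma hasSum_harmonicTerm_cons (N a x : ℕ) (l : List ℕ) {w : ℕ → ℝ} (hw : ∀ m, 0 ≤ w m)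
    (hl : ∀ M, HasSum (fun f : Fin l.length → ℕ =>
      open Classical in if ∀ i, f i < M then harmonicTerm N a l f else 0) (truncSum N a l M))
    {s : ℝ} (hs : HasSum (fun m => w m * seriesCoeff N a (x :: l) m) s) :
    HasSum (fun f : Fin (l.length + 1) → ℕ => w (f 0) * harmonicTerm N a (x :: l) f) s := by
  rw [← (Fin.consEquiv fun _ : Fin (l.length + 1) => ℕ).hasSum_iff]
  refine hasSum_prod_of_nonneg (fun p => mul_nonneg (hw _) (harmonicTerm_nonneg _ _ _ _))
    (fun m => ?_) hs
  have := (hl m).mul_left (w m * if 0 < m ∧ m % N = a % N then ((m : ℝ) ^ x)⁻¹ else 0)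
  rw [mul_assoc] at this
  refine hasSum_of_forall_eq (fun f => ?_) this
  rw [mul_assoc, ← harmonicTerm_cons]
  rfl

lemma hasSum_truncSum (N a : ℕ) (l : List ℕ) (M : ℕ) :
    HasSum (fun f : Fin l.length → ℕ =>
      open Classical in if ∀ i, f i < M then harmonicTerm N a l f else 0) (truncSum N a l M) := by
  classical
  induction l generalizing M with
  | nil =>
    have h : ∀ f : Fin ([] : List ℕ).length → ℕ,
        (if ∀ i, f i < M then harmonicTerm N a [] f else 0) = 1 := fun f => by
      have h1 : ∀ i, f i < M := fun i => i.elim0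
      have h2 : StrictAnti f ∧ ∀ i, 0 < f i ∧ f i % N = a % N :=
        ⟨fun i => i.elim0, fun i => i.elim0⟩
      rw [if_pos h1, harmonicTerm, if_pos h2]
      rfl
    have : IsEmpty (Fin ([] : List ℕ).length) := Fin.isEmpty
    have : Unique (Fin ([] : List ℕ).length → ℕ) := Pi.uniqueOfIsEmpty _
    simp only [h]
    exact hasSum_unique _
  | cons x l ih =>
    have hs : HasSum (fun m => (if m < M then (1 : ℝ) else 0) * seriesCoeff N a (x :: l) m)
        (truncSum N a (x :: l) M) := by
      rw [truncSum_eq_sum_seriesCoeff N a (by simp),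
        Finset.sum_congr rfl (g := fun m => (if m < M then (1 : ℝ) else 0) *
          seriesCoeff N a (x :: l) m) fun m hm => by simp [Finset.mem_range.1 hm]]
      exact hasSum_sum_of_ne_finset_zero fun m hm => by
        rw [if_neg (by simpa using hm), zero_mul]
    refine hasSum_of_forall_eq (fun f => ?_)
      (hasSum_harmonicTerm_cons N a x l (fun m => by split_ifs <;> simp) ih hs)
    by_cases hf : StrictAnti f
    · have : (∀ i, f i < M) ↔ f (0 : Fin (l.length + 1)) < M :=
        ⟨fun h => h _, fun h i => (hf.antitone (Fin.zero_le (n := l.length + 1) i)).trans_lt h⟩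
      by_cases h : f (0 : Fin (l.length + 1)) < M
      · rw [if_pos (this.2 h), if_pos h, one_mul]
      · rw [if_neg (mt this.1 h), if_neg h, zero_mul]
    · have : harmonicTerm N a (x :: l) f = 0 := if_neg fun h => hf h.1
      simp [this]

lemma hasSum_seriesCoeff (N a : ℕ) {p : List ℕ} (hp : p ≠ []) {z : ℝ} (hz0 : 0 ≤ z)
    (hz1 : z < 1) : HasSum (fun m => seriesCoeff N a p m * z ^ m) (Lv N a p z) := by
  classical
  cases p with
  | nil => exact absurd rfl hp
  | cons x l =>
    have hs := ((polyBounded_seriesCoeff N a (x :: l)).summable hz0 hz1).hasSum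
    have hs' := hs
    simp_rw [mul_comm _ (z ^ _)] at hs'
    have h := hasSum_harmonicTerm_cons N a x l (fun m => pow_nonneg hz0 m)
      (hasSum_truncSum N a l) hs'
    convert hs using 1
    rw [show (∑' m, seriesCoeff N a (x :: l) m * z ^ m) = _ from
      (tsum_congr fun m => mul_comm _ _).trans h.tsum_eq.symm]
    rw [Lv]
    refine Eq.trans ?_ (tsum_subtype {f : Fin (x :: l).length → ℕ |
      StrictAnti f ∧ ∀ i, 0 < f i ∧ f i % N = a % N} (fun f => z ^ f (0 : Fin (l.length + 1)) *
        ∏ i : Fin (x :: l).length, ((f i : ℝ) ^ (x :: l).get i)⁻¹)) |>.trans ?_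
    · refine tsum_congr fun f => ?_
      rw [dif_pos (by simp)]
      rfl
    · refine tsum_congr fun f => ?_
      rw [Set.indicator_apply, harmonicTerm, mul_ite, mul_zero]
      rfl

lemma iLv_eq_tsum_interpCoeff (N a : ℕ) (r : ℝ) {k : List ℕ} (hk : k ≠ []) {z : ℝ} (hz0 : 0 ≤ z)
    (hz1 : z < 1) : iLv N a r k z = ∑' m, interpCoeff N a r k m * z ^ m := by
  have key : ∀ L : List (List ℕ), (∀ p ∈ L, p ≠ []) →
      HasSum (fun m => (L.map fun p => r ^ (k.length - p.length) * seriesCoeff N a p m).sum * z ^ m)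
        (L.map fun p => r ^ (k.length - p.length) * Lv N a p z).sum := by
    intro L hL
    induction L with
    | nil => simp
    | cons p L ih =>
      have h1 := (hasSum_seriesCoeff N a (hL p (by simp)) hz0 hz1).mul_left
        (r ^ (k.length - p.length))
      have h2 := ih fun q hq => hL q (by simp [hq])
      simp only [List.map_cons, List.sum_cons]
      refine hasSum_of_forall_eq (fun m => ?_) (h1.add h2)
      ring
  have h := key (groupings k) fun p hp => (length_le_of_mem_groupings k p hp).2 hk
  simp only [sum_groupings_seriesCoeff N a r k _ hk] at h
  exact h.tsum_eq.symm

/-- The `i`-th factor (counted from `0`) of the integrand attached to the index `k`. -/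
noncomputable def kernelFactor (N a : ℕ) (r : ℝ) (k : List ℕ) (i : ℕ) (t : ℝ) : ℝ :=
  if i + 1 = k.sum then t ^ (a - 1) / (1 - t ^ N)
  else if i + 1 ∈ prefixSums k then r / t + t ^ (N - 1) / (1 - t ^ N)
  else 1 / t

lemma measurable_kernelFactor (N a : ℕ) (r : ℝ) (k : List ℕ) (i : ℕ) :
    Measurable (kernelFactor N a r k i) := by
  unfold kernelFactor
  split_ifs <;> fun_prop

lemma mem_prefixSums_cons_cons {x y : ℕ} {l : List ℕ} {j : ℕ} :
    j ∈ prefixSums (x :: y :: l) ↔ j = x ∨ ∃ i ∈ prefixSums (y :: l), j = x + i := by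
  simp only [prefixSums, List.length_cons, Nat.add_sub_cancel, List.range_succ_eq_map,
    List.map_cons, List.mem_cons, List.map_map, List.mem_map]
  simp [eq_comm]

lemma prefixSums_singleton (x : ℕ) : prefixSums [x] = [] := rfl

lemma succ_mem_prefixSums_succ_cons {x : ℕ} {l : List ℕ} {j : ℕ} :
    j + 1 ∈ prefixSums ((x + 1) :: l) ↔ j ∈ prefixSums (x :: l) := by
  cases l with
  | nil => simp [prefixSums_singleton]
  | cons y l =>
    simp only [mem_prefixSums_cons_cons, Nat.add_right_cancel_iff]
    simp only [show ∀ i, (j + 1 = x + 1 + i) = (j = x + i) by intro i; simp; omega]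

lemma pos_of_mem_prefixSums {k : List ℕ} (hk : ∀ i ∈ k, 1 ≤ i) {j : ℕ} (hj : j ∈ prefixSums k) :
    1 ≤ j := by
  match k with
  | [] => simp [prefixSums] at hj
  | [x] => simp [prefixSums] at hj
  | x :: y :: l =>
    have := hk x (by simp)
    rcases mem_prefixSums_cons_cons.1 hj with rfl | ⟨i, _, rfl⟩ <;> omega

lemma kernelFactor_succ_cons_succ (N a : ℕ) (r : ℝ) (x : ℕ) (l : List ℕ) (i : ℕ) :
    kernelFactor N a r ((x + 1) :: l) (i + 1) = kernelFactor N a r (x :: l) i := by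
  ext t
  unfold kernelFactor
  simp only [succ_mem_prefixSums_succ_cons]
  simp only [show (i + 1 + 1 = ((x + 1) :: l).sum) = (i + 1 = (x :: l).sum) by simp; omega]

lemma kernelFactor_succ_cons_zero (N a : ℕ) (r : ℝ) {x : ℕ} (hx : 1 ≤ x) {l : List ℕ}
    (hl : ∀ i ∈ l, 1 ≤ i) (t : ℝ) : kernelFactor N a r ((x + 1) :: l) 0 t = 1 / t := by
  unfold kernelFactor
  rw [if_neg (by simp; omega), if_neg]
  rw [succ_mem_prefixSums_succ_cons]
  intro h
  have : 1 ≤ 0 := pos_of_mem_prefixSums (by simpa using ⟨hx, hl⟩) h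
  omega

lemma kernelFactor_one_cons_succ (N a : ℕ) (r : ℝ) {y : ℕ} {l : List ℕ} (i : ℕ) :
    kernelFactor N a r (1 :: y :: l) (i + 1) = kernelFactor N a r (y :: l) i := by
  ext t
  unfold kernelFactor
  have h : i + 1 + 1 ∈ prefixSums (1 :: y :: l) ↔ i + 1 ∈ prefixSums (y :: l) := by
    rw [mem_prefixSums_cons_cons]
    constructor
    · rintro (h | ⟨j, hj, h⟩)
      · omega
      · rwa [show i + 1 = j by omega]
    · exact fun h => Or.inr ⟨_, h, by omega⟩
  simp only [h]
  simp only [show (i + 1 + 1 = (1 :: y :: l).sum) = (i + 1 = (y :: l).sum) by simp; omega]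

lemma kernelFactor_one_cons_zero (N a : ℕ) (r : ℝ) {y : ℕ} (hy : 1 ≤ y) {l : List ℕ} (t : ℝ) :
    kernelFactor N a r (1 :: y :: l) 0 t = r / t + t ^ (N - 1) / (1 - t ^ N) := by
  unfold kernelFactor
  rw [if_neg (by simp; omega), if_pos]
  rw [mem_prefixSums_cons_cons]
  exact Or.inl rfl

lemma kernelFactor_singleton_one (N a : ℕ) (r : ℝ) (t : ℝ) :
    kernelFactor N a r [1] 0 t = t ^ (a - 1) / (1 - t ^ N) := by
  simp [kernelFactor]

/-- On `(0, ρ)` the iterated integral attached to `k` converges absolutely, is `O(t)`, and has the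
expected power series. -/
def IsRepresentable (N a : ℕ) (r : ℝ) (ρ : ℝ) (k : List ℕ) : Prop :=
  ∃ K : ℝ, ∀ t ∈ Set.Ioo 0 ρ,
    Integrable (simplexIntegrand k.sum (kernelFactor N a r k) t) ∧
    ∫ y, ‖simplexIntegrand k.sum (kernelFactor N a r k) t y‖ ≤ K * t ∧
    ∫ y, simplexIntegrand k.sum (kernelFactor N a r k) t y = ∑' m, interpCoeff N a r k m * t ^ m

lemma IsRepresentable.prepend {N a : ℕ} {r ρ : ℝ} (hρ : ρ < 1) {k k' : List ℕ}
    (h : IsRepresentable N a r ρ k) (hsum : k'.sum = k.sum + 1)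
    (hsucc : ∀ i, kernelFactor N a r k' (i + 1) = kernelFactor N a r k i) {C : ℝ}
    (hC : ∀ t ∈ Set.Ioo 0 ρ, |kernelFactor N a r k' 0 t| * t ≤ C) {b : ℕ → ℝ} (hb : PolyBounded b)
    (hb0 : b 0 = 0)
    (hmul : ∀ t ∈ Set.Ioo 0 ρ, kernelFactor N a r k' 0 t * ∑' m, interpCoeff N a r k m * t ^ m =
      1 / t * ∑' m, b m * t ^ m)
    (hcoeff : ∀ m, interpCoeff N a r k' m = b m / m) : IsRepresentable N a r ρ k' := by
  obtain ⟨K, hK⟩ := h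
  refine ⟨C * |K|, fun z hz => ?_⟩
  have hsub : ∀ t ∈ Set.Ioo 0 z, t ∈ Set.Ioo 0 ρ := fun t ht => ⟨ht.1, ht.2.trans hz.2⟩
  have hfun : (fun i => kernelFactor N a r k' (i + 1)) = kernelFactor N a r k := funext hsucc
  have hstep := integral_simplexIntegrand_succ k.sum (measurable_kernelFactor N a r k')
    (K := C * |K|) hz.1 (by
      rw [hfun]
      exact fun t ht => (hK t (hsub t ht)).1) (by
      rw [hfun]
      intro t ht
      obtain ⟨-, h2, -⟩ := hK t (hsub t ht)
      calc |kernelFactor N a r k' 0 t| *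
            ∫ y, ‖simplexIntegrand k.sum (kernelFactor N a r k) t y‖
          ≤ |kernelFactor N a r k' 0 t| * (|K| * t) := by
            refine mul_le_mul_of_nonneg_left (h2.trans ?_) (abs_nonneg _)
            exact mul_le_mul_of_nonneg_right (le_abs_self K) ht.1.le
        _ = |kernelFactor N a r k' 0 t| * t * |K| := by ring
        _ ≤ C * |K| := mul_le_mul_of_nonneg_right (hC t (hsub t ht)) (abs_nonneg K))
  rw [hsum]
  refine ⟨hstep.1, hstep.2.1, hstep.2.2.trans ?_⟩
  rw [hfun]
  simp only [hcoeff]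
  rw [← integral_one_div_mul_tsum hb hb0 hz.1 (hz.2.trans hρ)]
  refine setIntegral_congr_fun measurableSet_Ioo fun t ht => ?_
  rw [← hmul t (hsub t ht), ← (hK t (hsub t ht)).2.2]

lemma one_sub_pow_pos {N : ℕ} (hN : 1 ≤ N) {t : ℝ} (h0 : 0 ≤ t) (h1 : t < 1) : 0 < 1 - t ^ N :=
  sub_pos.2 (pow_lt_one₀ h0 h1 (by omega))

lemma isRepresentable_singleton_one {N a : ℕ} (ha1 : 1 ≤ a) (ha2 : a ≤ N) (r : ℝ) {ρ : ℝ}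
    (hρ : ρ < 1) : IsRepresentable N a r ρ [1] := by
  have hN : 1 ≤ N := ha1.trans ha2
  refine ⟨1 / (1 - ρ), fun z hz => ?_⟩
  have hstep := integral_simplexIntegrand_succ 0 (measurable_kernelFactor N a r [1])
    (K := 1 / (1 - ρ)) hz.1 (fun t _ => (integral_simplexIntegrand_zero _ t).1) (by
      intro t ht
      rw [(integral_simplexIntegrand_zero _ t).2.1, mul_one, kernelFactor_singleton_one]
      have ht1 : t < 1 := ht.2.trans (hz.2.trans hρ)
      have h1 := one_sub_pow_pos hN ht.1.le ht1
      rw [abs_of_nonneg (div_nonneg (pow_nonneg ht.1.le _) h1.le)]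
      have h2 : t ^ N ≤ t := pow_le_of_le_one ht.1.le ht1.le (by omega)
      have h3 : t ^ (a - 1) ≤ 1 := pow_le_one₀ ht.1.le ht1.le
      have h4 := ht.2.trans hz.2
      gcongr
      linarith)
  refine ⟨hstep.1, hstep.2.1, hstep.2.2.trans ?_⟩
  have hb : PolyBounded fun m : ℕ => if 0 < m ∧ m % N = a % N then (1 : ℝ) else 0 :=
    (PolyBounded.const 1).mono fun m => by split_ifs <;> simp
  have := integral_one_div_mul_tsum hb (by simp) hz.1 (hz.2.trans hρ)
  refine Eq.trans ?_ (this.trans (tsum_congr fun m => ?_))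
  · refine setIntegral_congr_fun measurableSet_Ioo fun t ht => ?_
    rw [tsum_modEq ha1 ha2 ht.1.le (ht.2.trans (hz.2.trans hρ)),
      (integral_simplexIntegrand_zero _ t).2.2, kernelFactor_singleton_one]
    obtain ⟨b, rfl⟩ : ∃ b, a = b + 1 := ⟨a - 1, by omega⟩
    have := ht.1.ne'
    rw [Nat.add_sub_cancel, pow_succ]
    field_simp
  · simp only [interpCoeff]
    split_ifs <;> simp

lemma IsRepresentable.succ_cons {N a : ℕ} {r ρ : ℝ} (hρ : ρ < 1) {x : ℕ} (hx : 1 ≤ x) {l : List ℕ}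
    (hl : ∀ i ∈ l, 1 ≤ i) (h : IsRepresentable N a r ρ (x :: l)) :
    IsRepresentable N a r ρ ((x + 1) :: l) := by
  refine h.prepend hρ (by simp; omega) (kernelFactor_succ_cons_succ N a r x l) (C := 1) ?_
    (polyBounded_interpCoeff N a r (x :: l)) (interpCoeff_support N a r _ (by simp)) ?_ ?_
  · intro t ht
    have := ht.1.ne'
    rw [kernelFactor_succ_cons_zero N a r hx hl, abs_of_pos (one_div_pos.2 ht.1)]
    field_simp
    exact le_rfl
  · intro t _
    rw [kernelFactor_succ_cons_zero N a r hx hl]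
  · intro m
    rw [add_comm, interpCoeff_add_cons]
    by_cases hm : 0 < m ∧ m % N = a % N
    · rw [if_pos hm, pow_one]
      ring
    · rw [if_neg hm, interpCoeff_support N a r _ hm]
      simp

lemma IsRepresentable.one_cons {N a : ℕ} (hN : 1 ≤ N) {r ρ : ℝ} (hρ : ρ < 1) {y : ℕ} (hy : 1 ≤ y)
    {l : List ℕ} (h : IsRepresentable N a r ρ (y :: l)) :
    IsRepresentable N a r ρ (1 :: y :: l) := by
  set c := interpCoeff N a r (y :: l) with hc
  have hcb : PolyBounded c := polyBounded_interpCoeff N a r (y :: l)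
  have hsupp : ∀ m, ¬ (0 < m ∧ m % N = a % N) → c m = 0 := fun m =>
    interpCoeff_support N a r (y :: l)
  have hdb : PolyBounded fun m =>
      if 0 < m ∧ m % N = a % N then ∑ j ∈ Finset.range m, c j else 0 :=
    hcb.sum_range.mono fun m => by split_ifs <;> simp
  refine h.prepend hρ (by simp; omega) (kernelFactor_one_cons_succ N a r)
    (C := |r| + 1 / (1 - ρ)) ?_ ((hcb.const_mul r).add hdb) ?_ ?_ ?_
  · intro t ht
    have ht1 : t < 1 := ht.2.trans hρ
    have h1 := one_sub_pow_pos hN ht.1.le ht1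
    have ht0 := ht.1.ne'
    rw [kernelFactor_one_cons_zero N a r hy, ← abs_of_pos ht.1, ← abs_mul, abs_of_pos ht.1,
      add_mul, div_mul_cancel₀ r ht0]
    refine (abs_add_le _ _).trans (add_le_add le_rfl ?_)
    have h2 : t ^ N ≤ t := pow_le_of_le_one ht.1.le ht1.le (by omega)
    have h3 : t ^ (N - 1) * t ≤ 1 :=
      mul_le_one₀ (pow_le_one₀ ht.1.le ht1.le) ht.1.le ht1.le
    have h4 := ht.2
    rw [div_mul_eq_mul_div,
      abs_of_nonneg (div_nonneg (mul_nonneg (pow_nonneg ht.1.le _) ht.1.le) h1.le)]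
    gcongr
    linarith
  · simp [hsupp]
  · intro t ht
    have ht1 : t < 1 := ht.2.trans hρ
    have h1 := (one_sub_pow_pos hN ht.1.le ht1).ne'
    have ht0 := ht.1.ne'
    simp only [add_mul]
    rw [((hcb.const_mul r).summable ht.1.le ht1).tsum_add (hdb.summable ht.1.le ht1),
      tsum_sum_range_modEq hN hcb hsupp ht.1.le ht1, kernelFactor_one_cons_zero N a r hy]
    simp only [mul_assoc]
    rw [tsum_mul_left]
    obtain ⟨n, rfl⟩ : ∃ n, N = n + 1 := ⟨N - 1, by omega⟩
    rw [Nat.add_sub_cancel]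
    field_simp
    ring
  · intro m
    rw [interpCoeff, ← hc]
    by_cases hm : 0 < m ∧ m % N = a % N
    · rw [if_pos hm, if_pos hm, pow_one]
      ring
    · rw [if_neg hm, if_neg hm, hsupp m hm]
      simp

lemma isRepresentable {N a : ℕ} (ha1 : 1 ≤ a) (ha2 : a ≤ N) (r : ℝ) {ρ : ℝ} (hρ : ρ < 1)
    {k : List ℕ} (hne : k ≠ []) (hk : ∀ i ∈ k, 1 ≤ i) : IsRepresentable N a r ρ k := by
  induction k with
  | nil => exact absurd rfl hne
  | cons x l ih =>
    have hl : ∀ i ∈ l, 1 ≤ i := fun i hi => hk i (by simp [hi])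
    induction x, hk x (by simp) using Nat.le_induction with
    | base =>
      cases l with
      | nil => exact isRepresentable_singleton_one ha1 ha2 r hρ
      | cons y l => exact (ih (by simp) hl).one_cons (ha1.trans ha2) hρ (hl y (by simp))
    | succ x hx ihx => exact (ihx (by simp) (by simpa using ⟨hx, hl⟩)).succ_cons hρ hx hl

/-- Iterated-integral representation of `L^r_{N,a}(k;z)`: for `0 < z < 1`,
`L^r_{N,a}(k;z) = ∫_{z > z₁ > ⋯ > z_k > 0} ∏ᵢ fᵢ(zᵢ) dz₁⋯dz_k` where
`fᵢ(t) = r/t + t^{N-1}/(1-t^N)` if `i ∈ {k₁, k₁+k₂, …, k₁+⋯+k_{n-1}}`,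
`f_k(t) = t^{a-1}/(1-t^N)`, and `fᵢ(t) = 1/t` otherwise. -/
theorem stmt17 (N : ℕ) (hN : 1 ≤ N) (a : ℕ) (ha1 : 1 ≤ a) (ha2 : a ≤ N) (r : ℝ)
    (k : List ℕ) (hne : k ≠ []) (hk : ∀ i ∈ k, 1 ≤ i)
    (z : ℝ) (hz0 : 0 < z) (hz1 : z < 1) :
    iLv N a r k z =
      ∫ y in {y : Fin k.sum → ℝ | StrictAnti y ∧ ∀ i, 0 < y i ∧ y i < z},
        ∏ i : Fin k.sum,
          (if (i : ℕ) + 1 = k.sum then (y i) ^ (a - 1) / (1 - (y i) ^ N)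
           else if (i : ℕ) + 1 ∈ prefixSums k then
             r / (y i) + (y i) ^ (N - 1) / (1 - (y i) ^ N)
           else 1 / (y i)) := by
  rw [iLv_eq_tsum_interpCoeff N a r hne hz0.le hz1]
  obtain ⟨K, hK⟩ := isRepresentable ha1 ha2 r (show (1 + z) / 2 < 1 by linarith) hne hk
  rw [← (hK z ⟨hz0, by linarith⟩).2.2]
  exact integral_indicator (measurableSet_openSimplex k.sum z)
end
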